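/- arXiv:1804.08408 — 2 statements merged into one kernel-verified Lean document; each statement's English description precedes it below -/
import Mathlib

section
/- (Corollary 2: one missing observation.) Assume the setup below with S = {−s₀} for a fixed integer s₀ ≥ 1, and suppose c solves the normal system: Σ_{j∈Z^S} a(j)^⊤ R(k,j) = Σ_{j∈U} c(j)^⊤ B(k,j) for all k ∈ U. Then: (i) (1/2π)∫_{−π}^{π} h(λ)^⊤ e^{−ikλ} dλ = 0 for every k ∈ U; (ii) for every finitely supported b : ℤ → ℂ^T with support contained in Z₋∖{−s₀}, setting g(λ) = Σ_{n} b(n) e^{inλ}, one has Δ(h;F,G) ≤ Δ(g;F,G); and (iii) Δ(h;F,G) = Σ_{k∈U} ( Σ_{j∈Z^S} a(j)^⊤ R(k,j) ) conj(c(k)) + Σ_{j,k∈Z^S} a(j)^⊤ Q(j,k) conj(a(k)). -/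
open MeasureTheory
open scoped ComplexOrder

open Matrix in
/-- sesquilinear form -/
noncomputable def sf {T : ℕ} (N : Matrix (Fin T) (Fin T) ℂ) (u v : Fin T → ℂ) : ℂ :=
  (u ᵥ* N) ⬝ᵥ star v

lemma sf_eq {T : ℕ} (N : Matrix (Fin T) (Fin T) ℂ) (u v : Fin T → ℂ) :
    sf N u v = ∑ p, ∑ q, u p * N p q * (starRingEnd ℂ) (v q) := by
  simp only [sf, dotProduct, Matrix.vecMul, Finset.sum_mul, Pi.star_apply]
  rw [Finset.sum_comm]; rfl

section alg
open Matrix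
variable {T : ℕ}

lemma sf_sub_left (N : Matrix (Fin T) (Fin T) ℂ) (u u' v : Fin T → ℂ) :
    sf N (u - u') v = sf N u v - sf N u' v := by
  simp [sf, sub_vecMul, sub_dotProduct]

lemma sf_sub_right (N : Matrix (Fin T) (Fin T) ℂ) (u v v' : Fin T → ℂ) :
    sf N u (v - v') = sf N u v - sf N u v' := by
  simp [sf, dotProduct_sub]

lemma sf_add_mat (N N' : Matrix (Fin T) (Fin T) ℂ) (u v : Fin T → ℂ) :
    sf (N + N') u v = sf N u v + sf N' u v := by
  simp [sf, vecMul_add, add_dotProduct]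

lemma sf_conj {N : Matrix (Fin T) (Fin T) ℂ} (hN : N.IsHermitian) (u v : Fin T → ℂ) :
    (starRingEnd ℂ) (sf N u v) = sf N v u := by
  simp only [sf_eq, map_sum, map_mul, Complex.conj_conj]
  rw [Finset.sum_comm]
  refine Finset.sum_congr rfl fun p _ => Finset.sum_congr rfl fun q _ => ?_
  have : (starRingEnd ℂ) (N q p) = N p q := hN.apply p q
  rw [this]; ring

lemma sf_vecMul (K N : Matrix (Fin T) (Fin T) ℂ) (u v : Fin T → ℂ) :
    sf N (u ᵥ* K) v = sf (K * N) u v := by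
  simp [sf, vecMul_vecMul]

lemma sf_nonneg {N : Matrix (Fin T) (Fin T) ℂ} (hN : N.PosSemidef) (u : Fin T → ℂ) :
    0 ≤ sf N u u := by
  have := hN.dotProduct_mulVec_nonneg (star u)
  rw [star_star, dotProduct_mulVec] at this
  exact this

lemma psd_entry_bound {N : Matrix (Fin T) (Fin T) ℂ} (hN : N.PosSemidef) (u v : Fin T → ℂ) :
    ‖sf N u v‖ ≤ (sf N u u).re + (sf N v v).re := by
  obtain ⟨θ, hθ, hθ2⟩ : ∃ θ : ℂ, ‖θ‖ = 1 ∧ θ * sf N u v = ‖sf N u v‖ := by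
    by_cases h0 : sf N u v = 0
    · exact ⟨1, by simp, by simp [h0]⟩
    · have hn : (‖sf N u v‖ : ℂ) ≠ 0 := by simpa using h0
      refine ⟨(starRingEnd ℂ) (sf N u v) / ‖sf N u v‖, by simp [h0], ?_⟩
      rw [div_mul_eq_mul_div, Complex.conj_mul']
      field_simp
  have h1 := sf_nonneg hN (θ • u - v)
  have hs : sf N (θ • u - v) (θ • u - v) = sf N u u + sf N v v - θ * sf N u v
      - (starRingEnd ℂ) (θ * sf N u v) := by
    rw [sf_sub_left, sf_sub_right, sf_sub_right, map_mul, sf_conj hN.1]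
    have e1 : ∀ w, sf N (θ • u) w = θ * sf N u w := by
      intro w; simp [sf, smul_vecMul]
    have e2 : ∀ w, sf N w (θ • u) = (starRingEnd ℂ) θ * sf N w u := by
      intro w; simp [sf]
    have e3 : θ * (starRingEnd ℂ) θ = 1 := by rw [Complex.mul_conj']; simp [hθ]
    rw [e1, e1, e2, e2]
    linear_combination (sf N u u) * e3
  rw [hs, hθ2] at h1
  have := (Complex.le_def.1 h1).1
  simp at this
  have a1 := (Complex.le_def.1 (sf_nonneg hN u)).1
  have a2 := (Complex.le_def.1 (sf_nonneg hN v)).1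
  simp at a1 a2
  linarith [norm_nonneg (sf N u v)]

lemma sf_single (N : Matrix (Fin T) (Fin T) ℂ) (p q : Fin T) :
    sf N (Pi.single p 1) (Pi.single q 1) = N p q := by
  have : star (Pi.single q (1:ℂ) : Fin T → ℂ) = Pi.single q 1 := by
    ext i; by_cases h : i = q <;> simp [h]
  simp [sf, this]

variable {F G : Matrix (Fin T) (Fin T) ℂ}

lemma par_comm (hu : IsUnit (F + G)) : F * (F + G)⁻¹ * G = G * (F + G)⁻¹ * F := by
  have hd := (Matrix.isUnit_iff_isUnit_det _).1 hu
  have h1 : F * (F+G)⁻¹ * (F + G) = F := by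
    rw [mul_assoc, nonsing_inv_mul _ hd, mul_one]
  have h2 : (F+G) * (F+G)⁻¹ * F = F := by
    rw [mul_nonsing_inv _ hd, one_mul]
  rw [mul_add] at h1
  rw [add_mul, add_mul] at h2
  have := h1.trans h2.symm
  exact add_left_cancel this

lemma par_psd (hF : F.PosSemidef) (hG : G.PosSemidef) (hu : IsUnit (F + G)) :
    (F * (F + G)⁻¹ * G).PosSemidef := by
  have hd := (Matrix.isUnit_iff_isUnit_det _).1 hu
  have hM : ((F + G)⁻¹).IsHermitian := (hF.1.add hG.1).inv
  have e : F * (F + G)⁻¹ * G = (F * (F+G)⁻¹) * G * (F * (F+G)⁻¹)ᴴ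
      + (G * (F+G)⁻¹) * F * (G * (F+G)⁻¹)ᴴ := by
    rw [conjTranspose_mul, conjTranspose_mul, hM.eq, hF.1.eq, hG.1.eq]
    calc F * (F + G)⁻¹ * G = F * (F + G)⁻¹ * ((F + G) * (F + G)⁻¹) * G := by
          rw [mul_nonsing_inv _ hd, mul_one]
      _ = F * (F + G)⁻¹ * (F * (F + G)⁻¹ * G) + (F * (F + G)⁻¹ * G) * ((F + G)⁻¹ * G) := by
          noncomm_ring
      _ = F * (F + G)⁻¹ * (G * (F + G)⁻¹ * F) + (G * (F + G)⁻¹ * F) * ((F + G)⁻¹ * G) := by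
          rw [par_comm hu]
      _ = _ := by noncomm_ring
  rw [e]
  exact (hG.mul_mul_conjTranspose_same _).add (hF.mul_mul_conjTranspose_same _)

lemma par_bound (hF : F.PosSemidef) (hG : G.PosSemidef) (hu : IsUnit (F + G)) (p q : Fin T) :
    ‖(F * (F + G)⁻¹ * G) p q‖ ≤ ‖F p p‖ + ‖F q q‖ := by
  have hd := (Matrix.isUnit_iff_isUnit_det _).1 hu
  have hN := par_psd hF hG hu
  have hMi : ((F + G)⁻¹).PosSemidef := (hF.add hG).inv
  have key : ∀ p, (sf (F * (F + G)⁻¹ * G) (Pi.single p 1) (Pi.single p 1)).re ≤ ‖F p p‖ := by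
    intro p
    have e : F = F * (F + G)⁻¹ * G + F * (F + G)⁻¹ * Fᴴ := by
      rw [hF.1.eq, add_comm, ← mul_add, mul_assoc, nonsing_inv_mul _ hd, mul_one]
    have h1 : F p p = sf (F * (F + G)⁻¹ * G) (Pi.single p 1) (Pi.single p 1) +
       sf (F * (F + G)⁻¹ * Fᴴ) (Pi.single p 1) (Pi.single p 1) := by
      rw [← sf_add_mat, ← e, sf_single]
    have h2 := (Complex.le_def.1 (sf_nonneg (hMi.mul_mul_conjTranspose_same F)
      (Pi.single p 1))).1
    have h3 := congrArg Complex.re h1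
    simp only [Complex.add_re, Complex.zero_re] at h2 h3
    linarith [Complex.re_le_norm (F p p)]
  have := psd_entry_bound hN (Pi.single p 1) (Pi.single q 1)
  rw [sf_single] at this
  linarith [key p, key q]

lemma FM_bound (hF : F.PosSemidef) (hG : G.PosSemidef) (hu : IsUnit (F + G)) (p q : Fin T) :
    ‖(F * (F + G)⁻¹) p q‖ ≤ ‖F p p‖ + ‖(F + G)⁻¹ q q‖ := by
  have hd := (Matrix.isUnit_iff_isUnit_det _).1 hu
  have hM : ((F + G)⁻¹).IsHermitian := (hF.1.add hG.1).inv
  have hs : ∀ (N : Matrix (Fin T) (Fin T) ℂ) u, sf N u ((Pi.single q 1) ᵥ* (F + G)⁻¹)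
     = sf (N * (F + G)⁻¹) u (Pi.single q 1) := by
    intro N u
    simp only [sf, star_vecMul, hM.eq]
    rw [dotProduct_mulVec, vecMul_vecMul]
  have h := psd_entry_bound hF (Pi.single p 1) ((Pi.single q 1) ᵥ* (F + G)⁻¹)
  have h2 : (sf F ((Pi.single q 1) ᵥ* (F + G)⁻¹) ((Pi.single q 1) ᵥ* (F + G)⁻¹)).re
     ≤ ((F + G)⁻¹ q q).re := by
    have h3 : sf (F + G) ((Pi.single q 1) ᵥ* (F + G)⁻¹) ((Pi.single q 1) ᵥ* (F + G)⁻¹)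
      = (F + G)⁻¹ q q := by
      rw [hs, sf_vecMul, ← mul_assoc, nonsing_inv_mul _ hd, one_mul, sf_single]
    rw [sf_add_mat] at h3
    have h4 := (Complex.le_def.1 (sf_nonneg hG ((Pi.single q 1) ᵥ* (F + G)⁻¹))).1
    have h3 := congrArg Complex.re h3
    simp only [Complex.add_re, Complex.zero_re] at h3 h4
    linarith
  rw [hs, sf_single, sf_single] at h
  linarith [Complex.re_le_norm (F p p), Complex.re_le_norm ((F + G)⁻¹ q q)]

/-- completing the square -/
lemma square1 (hF : F.PosSemidef) (hG : G.PosSemidef) (hu : IsUnit (F + G))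
    (A C g h : Fin T → ℂ) (hh : h = A ᵥ* (F * (F + G)⁻¹) - C ᵥ* (F + G)⁻¹) :
    sf F (A - g) (A - g) + sf G g g =
      sf (F + G) (g - h) (g - h) - C ⬝ᵥ star (g - h) - (starRingEnd ℂ) (C ⬝ᵥ star (g - h))
      + (A ᵥ* (F * (F + G)⁻¹) - h) ⬝ᵥ star C + sf (F * (F + G)⁻¹ * G) A A := by
  have hd := (Matrix.isUnit_iff_isUnit_det _).1 hu
  have hMh : (F + G).IsHermitian := (hF.1.add hG.1)
  set k := C ᵥ* (F + G)⁻¹ with hk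
  set g0 := A ᵥ* (F * (F + G)⁻¹) with hg0
  have k1 : ∀ w, sf (F + G) k w = C ⬝ᵥ star w := by
    intro w; rw [hk, sf_vecMul, nonsing_inv_mul _ hd, sf, vecMul_one]
  have k2 : ∀ w, sf (F + G) w k = (starRingEnd ℂ) (C ⬝ᵥ star w) := by
    intro w; rw [← sf_conj hMh, k1]
  have g1 : ∀ w, sf (F + G) g0 w = sf F A w := by
    intro w; rw [hg0, sf_vecMul, mul_assoc, nonsing_inv_mul _ hd, mul_one]
  have g2 : ∀ w, sf (F + G) w g0 = sf F w A := by
    intro w; rw [← sf_conj hMh, g1, sf_conj hF.1]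
  have hN : sf F g0 A + sf (F * (F + G)⁻¹ * G) A A = sf F A A := by
    rw [hg0, sf_vecMul, ← sf_add_mat, ← mul_add, mul_assoc, nonsing_inv_mul _ hd, mul_one]
  have hw : g - h = (g - g0) + k := by rw [hh]; abel
  have hkk : (g0 - h) ⬝ᵥ star C = sf (F + G) k k := by
    rw [k2]; rw [hh]
    simp [dotProduct, mul_comm]
  rw [hkk, ← k2 (g - h), ← k1 (g - h)]
  have hd2 : sf (F + G) (g - g0) (g - g0) + sf (F * (F + G)⁻¹ * G) A A =
     sf F (A - g) (A - g) + sf G g g := by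
    simp only [sf_sub_left, sf_sub_right, g1, g2]
    rw [sf_add_mat]
    linear_combination hN
  rw [← hd2]
  have : g - g0 = (g - h) - k := by rw [hw]; abel
  rw [this]
  generalize g - h = w
  simp only [sf_sub_left, sf_sub_right]
  ring

end alg

section ana

lemma hasSum_cast {ι : Type*} {f g : ι → ℂ} {s t : ℂ} (h : HasSum f s) (hf : ∀ i, g i = f i)
    (hs : t = s) : HasSum g t := by
  rw [funext hf, hs]; exact h

lemma sum_int {ι : Type*} [Countable ι] (μ : Measure ℝ) {φ : ℝ → ℂ} (hφ : Integrable φ μ)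
    {α : ι → ℂ} (hα : Summable fun i => ‖α i‖) {e : ι → ℝ → ℂ} (he : ∀ i, Continuous (e i))
    (hn : ∀ i x, ‖e i x‖ ≤ 1) :
    HasSum (fun i => α i * ∫ x, φ x * e i x ∂μ) (∫ x, φ x * ∑' i, α i * e i x ∂μ) := by
  have hi : ∀ i, Integrable (fun x => φ x * (α i * e i x)) μ := fun i =>
    hφ.mul_bdd (c := ‖α i‖) ((continuous_const.mul (he i)).aestronglyMeasurable)
      (Filter.Eventually.of_forall fun x => by
        rw [norm_mul]; exact mul_le_of_le_one_right (norm_nonneg _) (hn i x))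
  have hs : Summable fun i => ∫ x, ‖φ x * (α i * e i x)‖ ∂μ := by
    refine Summable.of_nonneg_of_le (fun i => integral_nonneg fun x => norm_nonneg _)
      (fun i => ?_) (hα.mul_left (∫ x, ‖φ x‖ ∂μ))
    rw [← integral_mul_const]
    refine integral_mono (hi i).norm (hφ.norm.mul_const _) fun x => ?_
    simp only [norm_mul]
    exact mul_le_mul_of_nonneg_left (mul_le_of_le_one_right (norm_nonneg _) (hn i x))
      (norm_nonneg _)
  have := hasSum_integral_of_summable_integral_norm hi hs
  simp only [tsum_mul_left] at this
  have hc : (fun i => α i * ∫ x, φ x * e i x ∂μ) = fun i => ∫ x, φ x * (α i * e i x) ∂μ := by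
    funext i
    rw [← integral_const_mul]
    exact integral_congr_ae (Filter.Eventually.of_forall fun x => by ring)
  rw [hc]; exact this

lemma series_cont {ι : Type*} {α : ι → ℂ} (hα : Summable fun i => ‖α i‖) {e : ι → ℝ → ℂ}
    (he : ∀ i, Continuous (e i)) (hn : ∀ i x, ‖e i x‖ ≤ 1) :
    Continuous (fun x => ∑' i, α i * e i x) ∧ ∀ x, ‖∑' i, α i * e i x‖ ≤ ∑' i, ‖α i‖ := by
  have hb : ∀ i x, ‖α i * e i x‖ ≤ ‖α i‖ := fun i x => by
    rw [norm_mul]; exact mul_le_of_le_one_right (norm_nonneg _) (hn i x)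
  exact ⟨continuous_tsum (fun i => continuous_const.mul (he i)) hα hb,
    fun x => tsum_of_norm_bounded hα.hasSum fun i => hb i x⟩

lemma vec_hasSum {T : ℕ} (μ : Measure ℝ) {P : ℝ → Fin T → Fin T → ℂ}
    (hP : ∀ p q, Integrable (fun x => P x p q) μ)
    {a : ℤ → Fin T → ℂ} (ha : ∀ p, Summable fun j => ‖a j p‖) {e : ℤ → ℝ → ℂ}
    (he : ∀ i, Continuous (e i)) (hn : ∀ i x, ‖e i x‖ ≤ 1) (c0 : ℂ)
    (K : ℤ → Matrix (Fin T) (Fin T) ℂ) (hK : ∀ j p q, K j p q = c0 * ∫ x, P x p q * e j x ∂μ) :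
    HasSum (fun j => Matrix.vecMul (a j) (K j))
      (fun q => c0 * ∫ x, ∑ p, (∑' j, a j p * e j x) * P x p q ∂μ) := by
  rw [Pi.hasSum]
  intro q
  have hint : ∀ p, Integrable (fun x => (∑' j, a j p * e j x) * P x p q) μ := fun p =>
    (hP p q).bdd_mul (series_cont (ha p) he hn).1.aestronglyMeasurable
      (Filter.Eventually.of_forall (series_cont (ha p) he hn).2)
  rw [integral_finsetSum _ fun p _ => hint p, Finset.mul_sum]
  have : ∀ j, Matrix.vecMul (a j) (K j) q = ∑ p, c0 * (a j p * ∫ x, P x p q * e j x ∂μ) := by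
    intro j
    simp only [Matrix.vecMul, dotProduct, hK]
    exact Finset.sum_congr rfl fun p _ => by ring
  simp only [this]
  refine hasSum_sum fun p _ => ?_
  have := (sum_int μ (hP p q) (ha p) he hn).mul_left c0
  simpa only [mul_comm (P _ p q) (∑' j, a j p * e j _)] using this

lemma norm_ek (k : ℂ) (hk : k.im = 0) (x : ℝ) :
    ‖Complex.exp (-(Complex.I * k * (x : ℂ)))‖ ≤ 1 := by
  rw [Complex.norm_exp]; simp [hk]

lemma norm_ek2 (k : ℂ) (hk : k.im = 0) (x : ℝ) :
    ‖Complex.exp ((Complex.I * k * (x : ℂ)))‖ ≤ 1 := by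
  rw [Complex.norm_exp]; simp [hk]

lemma orth (n k : ℤ) (h : n ≠ k) :
    ∫ x in (-Real.pi)..Real.pi, Complex.exp (Complex.I * (n : ℂ) * (x : ℂ)) *
      Complex.exp (-(Complex.I * (k : ℂ) * (x : ℂ))) = 0 := by
  have hne : Complex.I * ((n : ℂ) - k) ≠ 0 :=
    mul_ne_zero Complex.I_ne_zero (sub_ne_zero.2 (by exact_mod_cast h))
  have : ∀ x : ℝ, Complex.exp (Complex.I * (n : ℂ) * (x : ℂ)) *
      Complex.exp (-(Complex.I * (k : ℂ) * (x : ℂ))) =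
      Complex.exp (Complex.I * ((n : ℂ) - k) * x) := by
    intro x; rw [← Complex.exp_add]; congr 1; ring
  simp only [this]
  rw [integral_exp_mul_complex hne]
  have h2 : Complex.exp (Complex.I * ((n : ℂ) - k) * (Real.pi : ℝ)) =
      Complex.exp (Complex.I * ((n : ℂ) - k) * ((-Real.pi : ℝ) : ℂ)) := by
    have := Complex.exp_int_mul_two_pi_mul_I (n - k)
    rw [← mul_one (Complex.exp (Complex.I * ((n : ℂ) - k) * ((-Real.pi : ℝ) : ℂ))), ← this,
      ← Complex.exp_add]
    congr 1; push_cast; ring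
  rw [h2]; simp

lemma conj_series (c : ℤ → ℂ) (x : ℝ) :
    (starRingEnd ℂ) (∑' j : ℤ, c j * Complex.exp (Complex.I * (j : ℂ) * (x : ℂ))) =
      ∑' j : ℤ, (starRingEnd ℂ) (c j) * Complex.exp (-(Complex.I * (j : ℂ) * (x : ℂ))) := by
  rw [Complex.conj_tsum]
  refine tsum_congr fun j => ?_
  rw [map_mul, ← Complex.exp_conj]; simp

lemma conj_series' (c : ℤ → ℂ) (x : ℝ) :
    (starRingEnd ℂ) (∑' j : ℤ, c j * Complex.exp (-(Complex.I * (j : ℂ) * (x : ℂ)))) =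
      ∑' j : ℤ, (starRingEnd ℂ) (c j) * Complex.exp (Complex.I * (j : ℂ) * (x : ℂ)) := by
  rw [Complex.conj_tsum]
  refine tsum_congr fun j => ?_
  rw [map_mul, ← Complex.exp_conj]; simp

end ana

set_option maxHeartbeats 2000000

/-- Corollary 2: one missing observation, `S = {−s₀}`: if `c` solves
the normal system then the Fourier coefficients
of `h` vanish on `U`, `h` is the optimal filter, and the mean-square error is given
by formula (55). -/
theorem stmt_11
    (T : ℕ) (s0 : ℤ) (hT : 1 ≤ T) (hs0 : 1 ≤ s0)
    (S U ZS Zneg : Set ℤ)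
    (hS : S = {-s0})
    (hU : U = S ∪ {j : ℤ | 0 ≤ j})
    (hZS : ZS = {j : ℤ | 1 ≤ j} \ {j : ℤ | -j ∈ S})
    (hZneg : Zneg = {j : ℤ | j < 0})
    (F G : ℝ → Matrix (Fin T) (Fin T) ℂ)
    (hFmeas : ∀ p q, Measurable fun x => F x p q)
    (hGmeas : ∀ p q, Measurable fun x => G x p q)
    (hFpsd : ∀ᵐ x : ℝ, x ∈ Set.Icc (-Real.pi) Real.pi → (F x).PosSemidef)
    (hGpsd : ∀ᵐ x : ℝ, x ∈ Set.Icc (-Real.pi) Real.pi → (G x).PosSemidef)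
    (hFint : ∀ p q, IntervalIntegrable (fun x => F x p q) volume (-Real.pi) Real.pi)
    (hGint : ∀ p q, IntervalIntegrable (fun x => G x p q) volume (-Real.pi) Real.pi)
    (hinv : ∀ᵐ x : ℝ, x ∈ Set.Icc (-Real.pi) Real.pi → IsUnit (F x + G x))
    (hmin : ∀ p q, IntervalIntegrable (fun x => (F x + G x)⁻¹ p q) volume (-Real.pi) Real.pi)
    (a : ℤ → Fin T → ℂ) (ha0 : ∀ j, j ∉ ZS → a j = 0)
    (haSum : Summable fun j : ℤ => ∑ k, ‖a j k‖)
    (A : ℝ → Fin T → ℂ)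
    (hA : ∀ x k, A x k = ∑' j : ℤ, a j k * Complex.exp (-(Complex.I * (j : ℂ) * (x : ℂ))))
    (c : ℤ → Fin T → ℂ) (hc0 : ∀ j, j ∉ U → c j = 0)
    (hcSum : Summable fun j : ℤ => ∑ k, ‖c j k‖)
    (Cf : ℝ → Fin T → ℂ)
    (hCf : ∀ x k, Cf x k = ∑' j : ℤ, c j k * Complex.exp (Complex.I * (j : ℂ) * (x : ℂ)))
    (h : ℝ → Fin T → ℂ)
    (hh : ∀ x, h x = Matrix.vecMul (A x) (F x * (F x + G x)⁻¹) -
      Matrix.vecMul (Cf x) (F x + G x)⁻¹)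
    (B R Q : ℤ → ℤ → Matrix (Fin T) (Fin T) ℂ)
    (hB : ∀ k j p q, B k j p q = (1 / (2 * (Real.pi : ℂ))) *
      ∫ x in (-Real.pi)..Real.pi,
        (F x + G x)⁻¹ p q * Complex.exp (-(Complex.I * ((k : ℂ) - (j : ℂ)) * (x : ℂ))))
    (hR : ∀ k j p q, R k j p q = (1 / (2 * (Real.pi : ℂ))) *
      ∫ x in (-Real.pi)..Real.pi,
        (F x * (F x + G x)⁻¹) p q * Complex.exp (-(Complex.I * ((k : ℂ) + (j : ℂ)) * (x : ℂ))))
    (hQ : ∀ k j p q, Q k j p q = (1 / (2 * (Real.pi : ℂ))) *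
      ∫ x in (-Real.pi)..Real.pi,
        (F x * (F x + G x)⁻¹ * G x) p q *
          Complex.exp (-(Complex.I * ((k : ℂ) - (j : ℂ)) * (x : ℂ))))
    (Δ : (ℝ → Fin T → ℂ) → ℂ)
    (hΔ : ∀ g : ℝ → Fin T → ℂ, Δ g =
      (1 / (2 * (Real.pi : ℂ))) * (∫ x in (-Real.pi)..Real.pi,
        ∑ p, ∑ q, (A x p - g x p) * F x p q * (starRingEnd ℂ) (A x q - g x q)) +
      (1 / (2 * (Real.pi : ℂ))) * (∫ x in (-Real.pi)..Real.pi,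
        ∑ p, ∑ q, g x p * G x p q * (starRingEnd ℂ) (g x q)))
    (hnormal : ∀ k ∈ U,
      (∑' j : ℤ, Matrix.vecMul (a j) (R k j)) = ∑' j : ℤ, Matrix.vecMul (c j) (B k j)) :
    (∀ k ∈ U, ∀ q, (1 / (2 * (Real.pi : ℂ))) *
        (∫ x in (-Real.pi)..Real.pi,
          h x q * Complex.exp (-(Complex.I * (k : ℂ) * (x : ℂ)))) = 0) ∧
    (∀ b : ℤ → Fin T → ℂ, (Function.support b).Finite →
      (∀ n : ℤ, b n ≠ 0 → n ∈ Zneg \ S) →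
      (Δ h).re ≤
        (Δ (fun x k => ∑' n : ℤ, b n k * Complex.exp (Complex.I * (n : ℂ) * (x : ℂ)))).re) ∧
    Δ h = (∑' k : ℤ, ∑ q,
        (∑' j : ℤ, Matrix.vecMul (a j) (R k j)) q * (starRingEnd ℂ) (c k q)) +
      ∑' jk : ℤ × ℤ, ∑ p, ∑ q,
        a jk.1 p * Q jk.1 jk.2 p q * (starRingEnd ℂ) (a jk.2 q) := by
  have hle : (-Real.pi) ≤ Real.pi := by linarith [Real.pi_pos]
  set μ : Measure ℝ := volume.restrict (Set.Ioc (-Real.pi) Real.pi) with hμ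
  simp only [intervalIntegral.integral_of_le hle, ← hμ] at hB hR hQ hΔ ⊢
  simp only [intervalIntegrable_iff_integrableOn_Ioc_of_le hle, IntegrableOn, ← hμ]
    at hFint hGint hmin
  set c0 : ℂ := 1 / (2 * (Real.pi : ℂ)) with hc0def
  have hae : ∀ {P : ℝ → Prop}, (∀ᵐ x : ℝ, x ∈ Set.Icc (-Real.pi) Real.pi → P x) →
      ∀ᵐ x ∂μ, P x := by
    intro P hP
    rw [hμ, ae_restrict_iff' measurableSet_Ioc]
    filter_upwards [hP] with x hx h1 using hx ⟨h1.1.le, h1.2⟩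
  replace hFpsd := hae hFpsd
  replace hGpsd := hae hGpsd
  replace hinv := hae hinv
  -- exponentials
  have hecont : ∀ k : ℤ, Continuous fun x : ℝ =>
      Complex.exp (-(Complex.I * (k : ℂ) * (x : ℂ))) := fun k => by fun_prop
  have hecont2 : ∀ k : ℤ, Continuous fun x : ℝ =>
      Complex.exp (Complex.I * (k : ℂ) * (x : ℂ)) := fun k => by fun_prop
  have hen : ∀ (k : ℤ) (x : ℝ), ‖Complex.exp (-(Complex.I * (k : ℂ) * (x : ℂ)))‖ ≤ 1 :=
    fun k x => norm_ek _ (by simp) x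
  have hen2 : ∀ (k : ℤ) (x : ℝ), ‖Complex.exp (Complex.I * (k : ℂ) * (x : ℂ))‖ ≤ 1 :=
    fun k x => norm_ek2 _ (by simp) x
  have hmule : ∀ {φ : ℝ → ℂ}, Integrable φ μ → ∀ k : ℤ, Integrable
      (fun x => φ x * Complex.exp (-(Complex.I * (k : ℂ) * (x : ℂ)))) μ := fun hφ k =>
    hφ.mul_bdd (hecont k).aestronglyMeasurable (Filter.Eventually.of_forall (hen k))
  -- coefficients
  have haS : ∀ p, Summable fun j => ‖a j p‖ := fun p =>
    Summable.of_nonneg_of_le (fun j => norm_nonneg _)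
      (fun j => Finset.single_le_sum (f := fun k => ‖a j k‖) (fun k _ => norm_nonneg _)
        (Finset.mem_univ p)) haSum
  have hcS : ∀ p, Summable fun j => ‖c j p‖ := fun p =>
    Summable.of_nonneg_of_le (fun j => norm_nonneg _)
      (fun j => Finset.single_le_sum (f := fun k => ‖c j k‖) (fun k _ => norm_nonneg _)
        (Finset.mem_univ p)) hcSum
  have hAc : ∀ p, Continuous fun x => A x p := fun p => by
    simp only [hA]; exact (series_cont (haS p) hecont hen).1
  have hAb : ∀ p, ∃ K, ∀ x, ‖A x p‖ ≤ K := fun p => by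
    simp only [hA]; exact ⟨_, (series_cont (haS p) hecont hen).2⟩
  have hCc : ∀ p, Continuous fun x => Cf x p := fun p => by
    simp only [hCf]; exact (series_cont (hcS p) hecont2 hen2).1
  have hCb : ∀ p, ∃ K, ∀ x, ‖Cf x p‖ ≤ K := fun p => by
    simp only [hCf]; exact ⟨_, (series_cont (hcS p) hecont2 hen2).2⟩
  have bmul : ∀ {φ f : ℝ → ℂ}, Integrable φ μ → Continuous f → (∃ K, ∀ x, ‖f x‖ ≤ K) →
      Integrable (fun x => f x * φ x) μ := by
    intro φ f hφ hf ⟨K, hK⟩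
    exact hφ.bdd_mul hf.aestronglyMeasurable (Filter.Eventually.of_forall hK)
  -- measurability and integrability of the matrices
  have hPm : ∀ p q, AEStronglyMeasurable (fun x => (F x * (F x + G x)⁻¹) p q) μ := by
    intro p q
    simp only [Matrix.mul_apply]
    exact Finset.aestronglyMeasurable_fun_sum _ fun r _ =>
      (hFint p r).1.mul (hmin r q).1
  have hNm : ∀ p q, AEStronglyMeasurable (fun x => (F x * (F x + G x)⁻¹ * G x) p q) μ := by
    intro p q
    simp only [Matrix.mul_apply (M := _ * _)]
    exact Finset.aestronglyMeasurable_fun_sum _ fun r _ =>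
      (hPm p r).mul (hGint r q).1
  have hPint : ∀ p q, Integrable (fun x => (F x * (F x + G x)⁻¹) p q) μ := by
    intro p q
    refine Integrable.mono' ((hFint p p).norm.add (hmin q q).norm) (hPm p q) ?_
    filter_upwards [hFpsd, hGpsd, hinv] with x h1 h2 h3 using FM_bound h1 h2 h3 p q
  have hNint : ∀ p q, Integrable (fun x => (F x * (F x + G x)⁻¹ * G x) p q) μ := by
    intro p q
    refine Integrable.mono' ((hFint p p).norm.add (hFint q q).norm) (hNm p q) ?_
    filter_upwards [hFpsd, hGpsd, hinv] with x h1 h2 h3 using par_bound h1 h2 h3 p q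
  -- g0 and k
  have hg0q : ∀ x q, Matrix.vecMul (A x) (F x * (F x + G x)⁻¹) q =
      ∑ p, A x p * (F x * (F x + G x)⁻¹) p q := fun x q => rfl
  have hkq : ∀ x q, Matrix.vecMul (Cf x) (F x + G x)⁻¹ q =
      ∑ p, Cf x p * (F x + G x)⁻¹ p q := fun x q => rfl
  have hg0int : ∀ q, Integrable (fun x => Matrix.vecMul (A x) (F x * (F x + G x)⁻¹) q) μ := by
    intro q; simp only [hg0q]
    exact integrable_finsetSum _ fun p _ => bmul (hPint p q) (hAc p) (hAb p)
  have hkint : ∀ q, Integrable (fun x => Matrix.vecMul (Cf x) (F x + G x)⁻¹ q) μ := by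
    intro q; simp only [hkq]
    exact integrable_finsetSum _ fun p _ => bmul (hmin p q) (hCc p) (hCb p)
  have hhint : ∀ q, Integrable (fun x => h x q) μ := by
    intro q; simp only [hh]; exact (hg0int q).sub (hkint q)
  -- Fourier coefficients
  have hRsum : ∀ k : ℤ, (∑' j : ℤ, Matrix.vecMul (a j) (R k j)) = fun q => c0 *
      ∫ x, Matrix.vecMul (A x) (F x * (F x + G x)⁻¹) q *
        Complex.exp (-(Complex.I * (k : ℂ) * (x : ℂ))) ∂μ := by
    intro k
    rw [(vec_hasSum μ (P := fun x p q => (F x * (F x + G x)⁻¹) p q *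
        Complex.exp (-(Complex.I * (k : ℂ) * (x : ℂ)))) (fun p q => hmule (hPint p q) k)
        haS hecont hen c0 (R k) ?_).tsum_eq]
    · funext q
      congr 1
      refine integral_congr_ae (Filter.Eventually.of_forall fun x => ?_)
      simp only [hg0q, Finset.sum_mul, hA, mul_assoc]
    · intro j p q
      rw [hR]
      congr 1
      refine integral_congr_ae (Filter.Eventually.of_forall fun x => ?_)
      simp only [mul_assoc]
      rw [← Complex.exp_add]
      congr 2; ring
  have hBsum : ∀ k : ℤ, (∑' j : ℤ, Matrix.vecMul (c j) (B k j)) = fun q => c0 *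
      ∫ x, Matrix.vecMul (Cf x) (F x + G x)⁻¹ q *
        Complex.exp (-(Complex.I * (k : ℂ) * (x : ℂ))) ∂μ := by
    intro k
    rw [(vec_hasSum μ (P := fun x p q => (F x + G x)⁻¹ p q *
        Complex.exp (-(Complex.I * (k : ℂ) * (x : ℂ)))) (fun p q => hmule (hmin p q) k)
        hcS hecont2 hen2 c0 (B k) ?_).tsum_eq]
    · funext q
      congr 1
      refine integral_congr_ae (Filter.Eventually.of_forall fun x => ?_)
      simp only [hkq, Finset.sum_mul, hCf, mul_assoc]
    · intro j p q
      rw [hB]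
      congr 1
      refine integral_congr_ae (Filter.Eventually.of_forall fun x => ?_)
      simp only [mul_assoc]
      rw [← Complex.exp_add]
      congr 2; ring
  have hi : ∀ k ∈ U, ∀ q, c0 * (∫ x,
      h x q * Complex.exp (-(Complex.I * (k : ℂ) * (x : ℂ))) ∂μ) = 0 := by
    intro k hk q
    have h1 := congrFun (hnormal k hk) q
    rw [hRsum, hBsum] at h1
    simp only at h1
    simp only [hh, Pi.sub_apply, sub_mul]
    rw [integral_sub (hmule (hg0int q) k) (hmule (hkint q) k), mul_sub, h1, sub_self]
  have hc0ne : c0 ≠ 0 := by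
    rw [hc0def]; simp [Real.pi_ne_zero]
  have hi' : ∀ k ∈ U, ∀ q, (∫ x,
      h x q * Complex.exp (-(Complex.I * (k : ℂ) * (x : ℂ))) ∂μ) = 0 := fun k hk q =>
    (mul_eq_zero.1 (hi k hk q)).resolve_left hc0ne
  have hcS' : ∀ q, Summable fun j => ‖(starRingEnd ℂ) (c j q)‖ := fun q => by
    simpa using hcS q
  have horth : ∀ (φ : ℝ → ℂ) q, Integrable φ μ →
      (∀ k ∈ U, ∫ x, φ x * Complex.exp (-(Complex.I * (k : ℂ) * (x : ℂ))) ∂μ = 0) →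
      ∫ x, φ x * (starRingEnd ℂ) (Cf x q) ∂μ = 0 := by
    intro φ q hφ hz
    have h1 := sum_int μ hφ (hcS' q) hecont hen
    simp only [hCf, conj_series (fun j => c j q)]
    refine h1.unique ?_
    refine hasSum_cast hasSum_zero (fun j => ?_) rfl
    by_cases hj : j ∈ U
    · rw [hz j hj, mul_zero]
    · simp [hc0 j hj]
  -- pieces
  set Dg : (ℝ → Fin T → ℂ) → ℝ → ℂ := fun g x => sf (F x) (A x - g x) (A x - g x) +
    sf (G x) (g x) (g x) with hDg
  have hsq : ∀ g : ℝ → Fin T → ℂ, ∀ᵐ x ∂μ, Dg g x =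
      sf (F x + G x) (g x - h x) (g x - h x) - Cf x ⬝ᵥ star (g x - h x)
      - (starRingEnd ℂ) (Cf x ⬝ᵥ star (g x - h x))
      + (Matrix.vecMul (A x) (F x * (F x + G x)⁻¹) - h x) ⬝ᵥ star (Cf x)
      + sf (F x * (F x + G x)⁻¹ * G x) (A x) (A x) := by
    intro g
    filter_upwards [hFpsd, hGpsd, hinv] with x h1 h2 h3 using
      square1 h1 h2 h3 (A x) (Cf x) (g x) (h x) (hh x)
  have cstar : ∀ {f : ℝ → ℂ}, Continuous f → Continuous fun x => (starRingEnd ℂ) (f x) :=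
    fun hf => Complex.continuous_conj.comp hf
  have hJ1 : ∀ q, Integrable (fun x => (starRingEnd ℂ) (Cf x q) *
      (Matrix.vecMul (A x) (F x * (F x + G x)⁻¹) q - h x q)) μ := fun q =>
    bmul ((hg0int q).sub (hhint q)) (cstar (hCc q))
      (by simpa only [RCLike.norm_conj] using hCb q)
  have hI1 : Integrable (fun x => (Matrix.vecMul (A x) (F x * (F x + G x)⁻¹) - h x) ⬝ᵥ
      star (Cf x)) μ := by
    simp only [dotProduct]
    refine integrable_finsetSum _ fun q _ => ?_
    exact (hJ1 q).congr (Filter.Eventually.of_forall fun x => mul_comm _ _)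
  have hI2 : ∀ p q, Integrable (fun x => A x p * (F x * (F x + G x)⁻¹ * G x) p q *
      (starRingEnd ℂ) (A x q)) μ := by
    intro p q
    have := bmul (bmul (hNint p q) (hAc p) (hAb p)) (cstar (hAc q))
      (by simpa only [RCLike.norm_conj] using hAb q)
    simpa only [mul_comm ((starRingEnd ℂ) _)] using this
  have hI2' : Integrable (fun x => sf (F x * (F x + G x)⁻¹ * G x) (A x) (A x)) μ := by
    simp only [sf_eq]
    exact integrable_finsetSum _ fun p _ => integrable_finsetSum _ fun q _ => hI2 p q
  have hDh : ∀ᵐ x ∂μ, Dg h x =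
      (Matrix.vecMul (A x) (F x * (F x + G x)⁻¹) - h x) ⬝ᵥ star (Cf x)
      + sf (F x * (F x + G x)⁻¹ * G x) (A x) (A x) := by
    filter_upwards [hsq h] with x hx
    rw [hx]; simp [sf]
  have hDhint : Integrable (Dg h) μ := (hI1.add hI2').congr (hDh.mono fun x hx => hx.symm)
  have sfm : ∀ {N : ℝ → Matrix (Fin T) (Fin T) ℂ} {u : ℝ → Fin T → ℂ},
      (∀ p q, AEStronglyMeasurable (fun x => N x p q) μ) →
      (∀ p, AEStronglyMeasurable (fun x => u x p) μ) →
      AEStronglyMeasurable (fun x => sf (N x) (u x) (u x)) μ := by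
    intro N u hN hu
    simp only [sf_eq]
    exact Finset.aestronglyMeasurable_fun_sum _ fun p _ =>
      Finset.aestronglyMeasurable_fun_sum _ fun q _ =>
        ((hu p).mul (hN p q)).mul (Complex.continuous_conj.comp_aestronglyMeasurable (hu q))
  -- splitting of Δ
  have hsplit : ∀ g : ℝ → Fin T → ℂ, (∀ q, AEStronglyMeasurable (fun x => g x q) μ) →
      Integrable (Dg g) μ → Δ g = c0 * ∫ x, Dg g x ∂μ := by
    intro g hg hgi
    have m1 : AEStronglyMeasurable (fun x => sf (F x) (A x - g x) (A x - g x)) μ :=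
      sfm (fun p q => (hFint p q).1) fun p => (hAc p).aestronglyMeasurable.sub (hg p)
    have m2 : AEStronglyMeasurable (fun x => sf (G x) (g x) (g x)) μ :=
      sfm (fun p q => (hGint p q).1) hg
    have key : ∀ {z w : ℂ}, 0 ≤ z → 0 ≤ w → ‖z‖ ≤ ‖z + w‖ := by
      intro z w hz hw
      have hw1 := (Complex.le_def.1 hw).1
      rw [← Complex.re_eq_norm.2 hz, ← Complex.re_eq_norm.2 (add_nonneg hz hw)]
      rw [Complex.add_re]
      rw [Complex.zero_re] at hw1
      linarith
    have i1 : Integrable (fun x => sf (F x) (A x - g x) (A x - g x)) μ := by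
      refine Integrable.mono hgi m1 ?_
      filter_upwards [hFpsd, hGpsd] with x h1 h2
      exact key (sf_nonneg h1 _) (sf_nonneg h2 _)
    have i2 : Integrable (fun x => sf (G x) (g x) (g x)) μ := by
      refine Integrable.mono hgi m2 ?_
      filter_upwards [hFpsd, hGpsd] with x h1 h2
      rw [hDg]; simp only; rw [add_comm]
      exact key (sf_nonneg h2 _) (sf_nonneg h1 _)
    rw [hΔ, hDg]
    simp only
    rw [integral_add i1 i2, mul_add]
    simp only [sf_eq, Pi.sub_apply]
  have hΔh := hsplit h (fun q => (hhint q).1) hDhint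
  refine ⟨hi, ?_, ?_⟩
  · intro b hbfin hb
    set g : ℝ → Fin T → ℂ := fun x k => ∑' n : ℤ, b n k *
      Complex.exp (Complex.I * (n : ℂ) * (x : ℂ)) with hgdef
    have hgs : ∀ x q, g x q = ∑ n ∈ hbfin.toFinset, b n q *
        Complex.exp (Complex.I * (n : ℂ) * (x : ℂ)) := by
      intro x q
      refine tsum_eq_sum fun n hn => ?_
      have : b n = 0 := by simpa using hn
      simp [this]
    have hbS : ∀ q, Summable fun n => ‖b n q‖ := by
      intro q
      refine summable_of_ne_finset_zero (s := hbfin.toFinset) fun n hn => ?_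
      have : b n = 0 := by simpa using hn
      simp [this]
    have hgc : ∀ q, Continuous fun x => g x q := fun q =>
      (series_cont (hbS q) hecont2 hen2).1
    have hgb : ∀ q, ∃ K, ∀ x, ‖g x q‖ ≤ K := fun q =>
      ⟨_, (series_cont (hbS q) hecont2 hen2).2⟩
    have one : Integrable (fun _ : ℝ => (1 : ℂ)) μ := integrable_const _
    have hgint : ∀ q, Integrable (fun x => g x q) μ := fun q => by
      simpa using bmul one (hgc q) (hgb q)
    have hgorth : ∀ q, ∀ k ∈ U,
        ∫ x, g x q * Complex.exp (-(Complex.I * (k : ℂ) * (x : ℂ))) ∂μ = 0 := by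
      intro q k hk
      have hik : ∀ n : ℤ, Integrable (fun x : ℝ => b n q *
        (Complex.exp (Complex.I * (n : ℂ) * (x : ℂ)) *
          Complex.exp (-(Complex.I * (k : ℂ) * (x : ℂ))))) μ := fun n => by
        refine Integrable.const_mul (hmule ?_ k) _
        simpa using bmul one (hecont2 n) ⟨1, hen2 n⟩
      simp only [hgs, Finset.sum_mul, mul_assoc] at hik ⊢
      rw [integral_finsetSum _ fun n _ => hik n]
      refine Finset.sum_eq_zero fun n hn => ?_
      rw [integral_const_mul]
      have hnk : n ≠ k := by
        have h1 := hb n (by simpa using hn)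
        rintro rfl
        rw [hU] at hk
        rw [hZneg] at h1
        rcases hk with hk | hk
        · exact h1.2 hk
        · exact absurd (show n < 0 from h1.1) (not_lt.2 hk)
      have := orth n k hnk
      rw [intervalIntegral.integral_of_le hle, ← hμ] at this
      simp only [mul_assoc] at this
      rw [this, mul_zero]
    -- cross term
    have hcq : ∀ q, Integrable (fun x => (g x q - h x q) * (starRingEnd ℂ) (Cf x q)) μ := by
      intro q
      have := bmul ((hgint q).sub (hhint q)) (cstar (hCc q))
        (by simpa only [RCLike.norm_conj] using hCb q)
      exact this.congr (Filter.Eventually.of_forall fun x => mul_comm _ _)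
    have hconj : ∀ x, (starRingEnd ℂ) (Cf x ⬝ᵥ star (g x - h x)) =
        ∑ q, (g x q - h x q) * (starRingEnd ℂ) (Cf x q) := by
      intro x
      simp [dotProduct, mul_comm]
    have hcrossI : Integrable (fun x => (starRingEnd ℂ) (Cf x ⬝ᵥ star (g x - h x))) μ := by
      simp only [hconj]
      exact integrable_finsetSum _ fun q _ => hcq q
    have hcross : ∫ x, (starRingEnd ℂ) (Cf x ⬝ᵥ star (g x - h x)) ∂μ = 0 := by
      simp only [hconj]
      rw [integral_finsetSum _ fun q _ => hcq q]
      refine Finset.sum_eq_zero fun q _ => ?_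
      refine horth (fun x => g x q - h x q) q ((hgint q).sub (hhint q)) fun k hk => ?_
      simp only [sub_mul]
      rw [integral_sub (hmule (hgint q) k) (hmule (hhint q) k), hgorth q k hk, hi' k hk q,
        sub_self]
    have hDgint : Integrable (Dg g) μ := by
      rw [hDg]
      simp only [sf_eq]
      refine Integrable.add ?_ ?_
      · refine integrable_finsetSum _ fun p _ => integrable_finsetSum _ fun q _ => ?_
        have b1 : ∀ p, ∃ K, ∀ x, ‖A x p - g x p‖ ≤ K := fun p => by
          obtain ⟨K1, h1⟩ := hAb p
          obtain ⟨K2, h2⟩ := hgb p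
          exact ⟨K1 + K2, fun x => (norm_sub_le _ _).trans (add_le_add (h1 x) (h2 x))⟩
        have c1 : ∀ p, Continuous fun x => A x p - g x p := fun p => (hAc p).sub (hgc p)
        have := bmul (bmul (hFint p q) (c1 p) (b1 p))
          (cstar (c1 q)) (by simpa only [RCLike.norm_conj] using b1 q)
        exact this.congr (Filter.Eventually.of_forall fun x => mul_comm _ _)
      · refine integrable_finsetSum _ fun p _ => integrable_finsetSum _ fun q _ => ?_
        have := bmul (bmul (hGint p q) (hgc p) (hgb p))
          (cstar (hgc q)) (by simpa only [RCLike.norm_conj] using hgb q)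
        simpa only [mul_comm ((starRingEnd ℂ) _)] using this
    have hΔg := hsplit g (fun q => (hgint q).1) hDgint
    rw [hΔg, hΔh]
    have hc0r : c0 = ((1 / (2 * Real.pi) : ℝ) : ℂ) := by rw [hc0def]; push_cast; rfl
    rw [hc0r, Complex.re_ofReal_mul, Complex.re_ofReal_mul]
    refine mul_le_mul_of_nonneg_left ?_ (by positivity)
    have hre : ∀ {f : ℝ → ℂ}, Integrable f μ → (∫ x, f x ∂μ).re = ∫ x, (f x).re ∂μ :=
      fun hf => (integral_re hf).symm
    have hcre : ∫ x, ((starRingEnd ℂ) (Cf x ⬝ᵥ star (g x - h x))).re ∂μ = 0 := by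
      rw [← hre hcrossI, hcross]; rfl
    rw [hre hDhint, hre hDgint]
    have hfin : ∫ x, ((Dg h x).re - 2 * ((starRingEnd ℂ) (Cf x ⬝ᵥ star (g x - h x))).re) ∂μ
        ≤ ∫ x, (Dg g x).re ∂μ := by
      refine integral_mono_ae (hDhint.re.sub (hcrossI.re.const_mul 2)) hDgint.re ?_
      filter_upwards [hsq g, hDh, hFpsd, hGpsd] with x h1 h2 h3 h4
      have h5 := (Complex.le_def.1 (sf_nonneg (h3.add h4) (g x - h x))).1
      rw [h1, h2]
      simp only [Complex.add_re, Complex.sub_re, Complex.conj_re, Complex.zero_re] at h5 ⊢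
      linarith
    have h2 : ∫ x, 2 * ((starRingEnd ℂ) (Cf x ⬝ᵥ star (g x - h x))).re ∂μ = 0 := by
      rw [integral_const_mul, hcre, mul_zero]
    have h3 : ∫ x, (Dg h x).re ∂μ - ∫ x, 2 * ((starRingEnd ℂ) (Cf x ⬝ᵥ star (g x - h x))).re ∂μ
      ≤ ∫ x, (Dg g x).re ∂μ :=
      (integral_sub hDhint.re (hcrossI.re.const_mul 2)).symm.trans_le hfin
    rw [h2, sub_zero] at h3
    exact h3
  · rw [hΔh, integral_congr_ae hDh, integral_add hI1 hI2', mul_add]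
    congr 1
    · -- first term
      have hφ : ∀ q, Integrable (fun x =>
          Matrix.vecMul (A x) (F x * (F x + G x)⁻¹) q - h x q) μ := fun q =>
        (hg0int q).sub (hhint q)
      have hs : HasSum (fun k : ℤ => ∑ q,
          (∑' j : ℤ, Matrix.vecMul (a j) (R k j)) q * (starRingEnd ℂ) (c k q))
          (∑ q, c0 * ∫ x, (Matrix.vecMul (A x) (F x * (F x + G x)⁻¹) q - h x q) *
            (starRingEnd ℂ) (Cf x q) ∂μ) := by
        refine hasSum_sum fun q _ => ?_
        have h1 := (sum_int μ (hφ q) (hcS' q) hecont hen).mul_left c0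
        simp only [hCf, conj_series (fun j => c j q)]
        refine hasSum_cast h1 (fun k => ?_) rfl
        by_cases hk : k ∈ U
        · rw [hRsum]
          simp only [sub_mul]
          rw [integral_sub (hmule (hg0int q) k) (hmule (hhint q) k), hi' k hk q]
          ring
        · simp [hc0 k hk]
      rw [hs.tsum_eq, ← Finset.mul_sum]
      congr 1
      simp only [dotProduct, Pi.sub_apply, Pi.star_apply]
      rw [integral_finsetSum]
      · rfl
      · intro q _
        exact (hJ1 q).congr (Filter.Eventually.of_forall fun x => mul_comm _ _)
    · have hs : HasSum (fun jk : ℤ × ℤ => ∑ p, ∑ q,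
          a jk.1 p * Q jk.1 jk.2 p q * (starRingEnd ℂ) (a jk.2 q))
          (∑ p, ∑ q, c0 * ∫ x, A x p * (F x * (F x + G x)⁻¹ * G x) p q *
            (starRingEnd ℂ) (A x q) ∂μ) := by
        refine hasSum_sum fun p _ => hasSum_sum fun q _ => ?_
        have haS' : Summable fun j => ‖(starRingEnd ℂ) (a j q)‖ := by simpa using haS q
        have hsm : Summable fun jk : ℤ × ℤ => ‖a jk.1 p * (starRingEnd ℂ) (a jk.2 q)‖ := by
          simp only [norm_mul]
          exact (haS p).mul_of_nonneg haS' (fun _ => norm_nonneg _) (fun _ => norm_nonneg _)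
        have h1 := (sum_int μ (hNint p q) hsm
          (e := fun jk x => Complex.exp (-(Complex.I * (jk.1 : ℂ) * (x : ℂ))) *
            Complex.exp (Complex.I * (jk.2 : ℂ) * (x : ℂ)))
          (fun jk => (hecont jk.1).mul (hecont2 jk.2)) (fun jk x => by
            rw [norm_mul]
            exact mul_le_one₀ (hen _ _) (norm_nonneg _) (hen2 _ _))).mul_left c0
        refine hasSum_cast h1 (fun jk => ?_) ?_
        · rw [hQ]
          have : ∀ x : ℝ, Complex.exp (-(Complex.I * (jk.1 : ℂ) * (x : ℂ))) *
            Complex.exp (Complex.I * (jk.2 : ℂ) * (x : ℂ)) =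
            Complex.exp (-(Complex.I * ((jk.1 : ℂ) - (jk.2 : ℂ)) * (x : ℂ))) := by
            intro x; rw [← Complex.exp_add]; congr 1; ring
          simp only [this]
          ring
        · congr 1
          refine integral_congr_ae (Filter.Eventually.of_forall fun x => ?_)
          have hn1 : Summable fun j : ℤ =>
              ‖a j p * Complex.exp (-(Complex.I * (j : ℂ) * (x : ℂ)))‖ :=
            Summable.of_nonneg_of_le (fun j => norm_nonneg _) (fun j => by
              rw [norm_mul]; exact mul_le_of_le_one_right (norm_nonneg _) (hen j x)) (haS p)
          have hn2 : Summable fun j : ℤ =>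
              ‖(starRingEnd ℂ) (a j q) * Complex.exp (Complex.I * (j : ℂ) * (x : ℂ))‖ :=
            Summable.of_nonneg_of_le (fun j => norm_nonneg _) (fun j => by
              rw [norm_mul]; exact mul_le_of_le_one_right (norm_nonneg _) (hen2 j x)) haS'
          have h2 := tsum_mul_tsum_of_summable_norm hn1 hn2
          simp only
          rw [mul_right_comm, hA, hA, conj_series' (fun j => a j q), h2, mul_comm]
          congr 1
          exact tsum_congr fun jk => by ring
      rw [hs.tsum_eq]
      simp only [sf_eq, ← Finset.mul_sum]
      congr 1
      rw [integral_finsetSum _ fun p _ => integrable_finsetSum _ fun q _ => hI2 p q]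
      refine Finset.sum_congr rfl fun p _ => ?_
      rw [integral_finsetSum _ fun q _ => hI2 p q]
end

section
/- (Corollary 3: filtering of the truncated functional A_N ξ.) Assume the setup below, fix N ≥ 1, and suppose a vanishes outside Z^S ∩ {1,…,N} (so A(λ) = Σ_{j∈Z^S, j≤N} a(j) e^{−ijλ} is a trigonometric polynomial). Suppose c solves the normal system: Σ_{j∈Z^S} a(j)^⊤ R(k,j) = Σ_{j∈U} c(j)^⊤ B(k,j) for all k ∈ U. Then: (i) (1/2π)∫_{−π}^{π} h(λ)^⊤ e^{−ikλ} dλ = 0 for every k ∈ U; (ii) Δ(h;F,G) ≤ Δ(g;F,G) for every g(λ) = Σ_{n∈Z₋∖S} b(n) e^{inλ} with b finitely supported in Z₋∖S; and (iii) Δ(h;F,G) = Σ_{k∈U} ( Σ_{j∈Z^S} a(j)^⊤ R(k,j) ) conj(c(k)) + Σ_{j,k∈Z^S} a(j)^⊤ Q(j,k) conj(a(k)). -/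
open MeasureTheory
open scoped ComplexOrder

/-- The sesquilinear form `u^⊤ M conj v`. -/
def sform {n : ℕ} (M : Matrix (Fin n) (Fin n) ℂ) (u v : Fin n → ℂ) : ℂ :=
  ∑ p, ∑ q, u p * M p q * (starRingEnd ℂ) (v q)

section alg
open Matrix
variable {n : ℕ}

lemma sform_eq (M : Matrix (Fin n) (Fin n) ℂ) (u v : Fin n → ℂ) :
    sform M u v = u ⬝ᵥ (M *ᵥ star v) := by
  simp [sform, dotProduct, mulVec, Finset.mul_sum, mul_assoc]

lemma sform_sub_left (M : Matrix (Fin n) (Fin n) ℂ) (u w v : Fin n → ℂ) :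
    sform M (u - w) v = sform M u v - sform M w v := by
  simp [sform_eq, sub_dotProduct]

lemma sform_sub_right (M : Matrix (Fin n) (Fin n) ℂ) (u v w : Fin n → ℂ) :
    sform M u (v - w) = sform M u v - sform M u w := by
  simp [sform_eq, mulVec_sub, dotProduct_sub]

lemma sform_smul_left (M : Matrix (Fin n) (Fin n) ℂ) (z : ℂ) (u v : Fin n → ℂ) :
    sform M (z • u) v = z * sform M u v := by
  simp [sform_eq]

lemma sform_smul_right (M : Matrix (Fin n) (Fin n) ℂ) (z : ℂ) (u v : Fin n → ℂ) :
    sform M u (z • v) = star z * sform M u v := by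
  simp [sform_eq, mulVec_smul]

lemma sform_add (M N : Matrix (Fin n) (Fin n) ℂ) (u v : Fin n → ℂ) :
    sform (M + N) u v = sform M u v + sform N u v := by
  simp [sform_eq, add_mulVec]

lemma sform_sub (M N : Matrix (Fin n) (Fin n) ℂ) (u v : Fin n → ℂ) :
    sform (M - N) u v = sform M u v - sform N u v := by
  simp [sform_eq, sub_mulVec]

lemma sform_vecMul_left (M N : Matrix (Fin n) (Fin n) ℂ) (u v : Fin n → ℂ) :
    sform M (u ᵥ* N) v = sform (N * M) u v := by
  simp [sform_eq, ← mulVec_mulVec, dotProduct_mulVec]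

lemma sform_vecMul_right (M N : Matrix (Fin n) (Fin n) ℂ) (u v : Fin n → ℂ) :
    sform M u (v ᵥ* N) = sform (M * Nᴴ) u v := by
  simp [sform_eq, ← mulVec_mulVec, star_vecMul]

lemma sform_single (M : Matrix (Fin n) (Fin n) ℂ) (p q : Fin n) :
    sform M (Pi.single p 1) (Pi.single q 1) = M p q := by
  simp [sform, Pi.single_apply]

lemma sform_nonneg {M : Matrix (Fin n) (Fin n) ℂ} (hM : M.PosSemidef) (u : Fin n → ℂ) :
    0 ≤ sform M u u := by
  rw [sform_eq]
  simpa using hM.dotProduct_mulVec_nonneg (star u)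

lemma sform_star {M : Matrix (Fin n) (Fin n) ℂ} (hM : M.IsHermitian) (u v : Fin n → ℂ) :
    star (sform M u v) = sform M v u := by
  simp only [sform, star_sum]
  rw [Finset.sum_comm]
  refine Finset.sum_congr rfl fun q _ => Finset.sum_congr rfl fun p _ => ?_
  have := hM.apply q p
  simp only [star_mul', RCLike.star_def, RingHomCompTriple.comp_apply, RingHom.id_apply] at *
  rw [this]; ring

/-- Cauchy-Schwarz in additive form. -/
lemma sform_norm_le {M : Matrix (Fin n) (Fin n) ℂ} (hM : M.IsHermitian)
    (h0 : ∀ u, 0 ≤ sform M u u) (u v : Fin n → ℂ) :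
    ‖sform M u v‖ ≤ (sform M u u).re + (sform M v v).re := by
  obtain ⟨ω, hω1, hω⟩ : ∃ ω : ℂ, ‖ω‖ = 1 ∧ star ω * sform M u v = ‖sform M u v‖ := by
    by_cases hz : sform M u v = 0
    · exact ⟨1, by simp, by simp [hz]⟩
    · refine ⟨sform M u v / ‖sform M u v‖, by simp [hz], ?_⟩
      have : (‖sform M u v‖ : ℂ) ≠ 0 := by simpa using hz
      simp only [star_div₀, RCLike.star_def, Complex.conj_ofReal]
      field_simp
      rw [mul_comm, Complex.mul_conj, Complex.normSq_eq_norm_sq]; push_cast; rfl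
  have h1 := h0 (u - ω • v)
  have h2 : ω * sform M v u = ‖sform M u v‖ := by
    have := congrArg star hω
    rw [star_mul', star_star, sform_star hM] at this
    simpa using this
  have h3 : star ω * ω = 1 := by
    have := Complex.mul_conj ω
    rw [Complex.normSq_eq_norm_sq, hω1] at this
    rw [mul_comm]; simpa using this
  rw [sform_sub_left, sform_sub_right, sform_sub_right, sform_smul_left, sform_smul_right,
    sform_smul_left, sform_smul_right, hω, h2, ← mul_assoc, mul_comm ω, h3] at h1
  have h4 := (Complex.le_def.1 h1).1
  simp at h4
  have := (Complex.le_def.1 (h0 u)).1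
  have := (Complex.le_def.1 (h0 v)).1
  simp at *
  linarith [norm_nonneg (sform M u v)]

section FG
variable {F G : Matrix (Fin n) (Fin n) ℂ}

/-- completing the square -/
lemma sform_square (hF : F.PosSemidef) (hG : G.PosSemidef) (hV : IsUnit (F + G))
    (A C g : Fin n → ℂ) (h : Fin n → ℂ)
    (hh : h = A ᵥ* (F * (F + G)⁻¹) - C ᵥ* (F + G)⁻¹) :
    sform F (A - g) (A - g) + sform G g g =
      sform (F + G) (g - h) (g - h) - sform 1 C (g - h) - sform 1 (g - h) C
        + (sform (F + G)⁻¹ C C + sform (F * (F + G)⁻¹ * G) A A) := by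
  have hFh := hF.1
  have hVh : (F + G).IsHermitian := hF.1.add hG.1
  have hWh : (F + G)⁻¹.IsHermitian := hVh.inv
  have hd := (isUnit_iff_isUnit_det _).1 hV
  generalize hVe : F + G = V at *
  have hGe : G = V - F := by rw [← hVe]; abel
  have hVW : V * V⁻¹ = 1 := mul_nonsing_inv _ hd
  have hWV : V⁻¹ * V = 1 := nonsing_inv_mul _ hd
  have e2 : ∀ X, V * (V⁻¹ * X) = X := by intro X; rw [← mul_assoc, hVW, one_mul]
  clear hVe
  subst hh
  rw [hGe]
  simp only [sform_sub_left, sform_sub_right, sform_vecMul_left, sform_vecMul_right,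
    conjTranspose_mul, hFh.eq, hWh.eq, sform_sub, mul_sub, e2, hVW, hWV, one_mul,
    mul_one, mul_assoc]
  ring

lemma sform_FWG_nonneg (hF : F.PosSemidef) (hG : G.PosSemidef) (hV : IsUnit (F + G))
    (A : Fin n → ℂ) : 0 ≤ sform (F * (F + G)⁻¹ * G) A A := by
  have := sform_square hF hG hV A 0 (A ᵥ* (F * (F + G)⁻¹)) _ rfl
  have h0 : ∀ M : Matrix (Fin n) (Fin n) ℂ, sform M 0 0 = 0 := by intro M; simp [sform]
  simp only [zero_vecMul, sub_zero, sub_self, h0, zero_add] at this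
  rw [← this]
  exact add_nonneg (sform_nonneg hF _) (sform_nonneg hG _)

lemma FWG_eq (hV : IsUnit (F + G)) :
    F * (F + G)⁻¹ * G = F - F * (F + G)⁻¹ * F := by
  have hd := (isUnit_iff_isUnit_det _).1 hV
  have : F * (F + G)⁻¹ * (F + G) = F := by rw [mul_assoc, nonsing_inv_mul _ hd, mul_one]
  rw [mul_add] at this
  rw [eq_sub_iff_add_eq, add_comm]; exact this

lemma norm_FWG_le (hF : F.PosSemidef) (hG : G.PosSemidef) (hV : IsUnit (F + G)) (p q : Fin n) :
    ‖(F * (F + G)⁻¹ * G) p q‖ ≤ ‖F p p‖ + ‖F q q‖ := by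
  have hW : (F + G)⁻¹.PosSemidef := (hF.add hG).inv
  have hH : (F * (F + G)⁻¹ * G).IsHermitian := by
    rw [FWG_eq hV]
    refine hF.1.sub ?_
    simp [IsHermitian, conjTranspose_mul, hF.1.eq, hW.1.eq, mul_assoc]
  have key : ∀ p : Fin n, ((F * (F + G)⁻¹ * G) p p).re ≤ ‖F p p‖ := by
    intro p
    refine le_trans ?_ (Complex.re_le_norm _)
    rw [FWG_eq hV]
    have := sform_nonneg hW (Pi.single p 1 ᵥ* F)
    rw [sform_vecMul_left, sform_vecMul_right, hF.1.eq, sform_single] at this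
    have := (Complex.le_def.1 this).1
    simp only [Complex.zero_re] at this
    rw [Matrix.sub_apply, Complex.sub_re]
    linarith
  have := sform_norm_le hH (sform_FWG_nonneg hF hG hV) (Pi.single p 1) (Pi.single q 1)
  simp only [sform_single] at this
  linarith [key p, key q]

lemma norm_FW_le (hF : F.PosSemidef) (hG : G.PosSemidef) (hV : IsUnit (F + G)) (p q : Fin n) :
    ‖(F * (F + G)⁻¹) p q‖ ≤ ‖F p p‖ + ‖(F + G)⁻¹ q q‖ := by
  have hd := (isUnit_iff_isUnit_det _).1 hV
  have hW : (F + G)⁻¹.PosSemidef := (hF.add hG).inv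
  have := sform_norm_le hF.1 (sform_nonneg hF) (Pi.single p 1) (Pi.single q 1 ᵥ* (F + G)⁻¹)
  rw [sform_vecMul_right, hW.1.eq, sform_single, sform_single] at this
  have h1 := sform_nonneg hG (Pi.single q 1 ᵥ* (F + G)⁻¹)
  have h2 := sform_add F G (Pi.single q 1 ᵥ* (F + G)⁻¹) (Pi.single q 1 ᵥ* (F + G)⁻¹)
  rw [sform_vecMul_right (F + G), sform_vecMul_left (_ * _), hW.1.eq, mul_nonsing_inv _ hd,
    mul_one, sform_single] at h2
  have h3 := (Complex.le_def.1 h1).1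
  have h4 := congrArg Complex.re h2
  simp only [Complex.zero_re, Complex.add_re] at h3 h4
  linarith [Complex.re_le_norm (F p p), Complex.re_le_norm ((F + G)⁻¹ q q)]
end FG
end alg

section ana

/-- bounded continuous functions -/
def BCfun (f : ℝ → ℂ) : Prop := Continuous f ∧ ∃ K, ∀ x, ‖f x‖ ≤ K

lemma BCfun.mul {f g : ℝ → ℂ} (hf : BCfun f) (hg : BCfun g) : BCfun fun x => f x * g x := by
  obtain ⟨cf, K, hK⟩ := hf
  obtain ⟨cg, L, hL⟩ := hg
  refine ⟨cf.mul cg, K * L, fun x => ?_⟩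
  rw [norm_mul]
  exact mul_le_mul (hK x) (hL x) (norm_nonneg _) ((norm_nonneg _).trans (hK x))

lemma BCfun.sub {f g : ℝ → ℂ} (hf : BCfun f) (hg : BCfun g) : BCfun fun x => f x - g x := by
  obtain ⟨cf, K, hK⟩ := hf
  obtain ⟨cg, L, hL⟩ := hg
  exact ⟨cf.sub cg, K + L, fun x => (norm_sub_le _ _).trans (add_le_add (hK x) (hL x))⟩

lemma BCfun.conj {f : ℝ → ℂ} (hf : BCfun f) : BCfun fun x => (starRingEnd ℂ) (f x) := by
  obtain ⟨cf, K, hK⟩ := hf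
  exact ⟨Complex.continuous_conj.comp cf, K, fun x => by simpa using hK x⟩

/-- continuous functions of modulus at most one -/
def UBfun (f : ℝ → ℂ) : Prop := Continuous f ∧ ∀ x, ‖f x‖ ≤ 1

lemma UBfun.bc {f : ℝ → ℂ} (hf : UBfun f) : BCfun f := ⟨hf.1, 1, hf.2⟩

lemma ub_exp (w : ℝ) : UBfun fun x : ℝ => Complex.exp (Complex.I * (w : ℂ) * (x : ℂ)) := by
  refine ⟨by fun_prop, fun x => ?_⟩
  rw [Complex.norm_exp]; simp

lemma bc_tsum {ι : Type*} {γ : ι → ℂ} (hγ : Summable fun i => ‖γ i‖) {φ : ι → ℝ → ℂ}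
    (hφ : ∀ i, UBfun (φ i)) : BCfun fun x => ∑' i, γ i * φ i x := by
  have hb : ∀ i x, ‖γ i * φ i x‖ ≤ ‖γ i‖ := fun i x => by
    rw [norm_mul]; exact mul_le_of_le_one_right (norm_nonneg _) ((hφ i).2 x)
  refine ⟨continuous_tsum (fun i => continuous_const.mul (hφ i).1) hγ hb, ∑' i, ‖γ i‖,
    fun x => tsum_of_norm_bounded hγ.hasSum fun i => hb i x⟩

variable {μ : Measure ℝ}

lemma int_mul_bc {f g : ℝ → ℂ} (hf : Integrable f μ) (hg : BCfun g) :
    Integrable (fun x => f x * g x) μ := by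
  obtain ⟨cg, L, hL⟩ := hg
  exact hf.mul_bdd (c := L) cg.aestronglyMeasurable (Filter.Eventually.of_forall hL)

lemma hasSum_int {ι : Type*} [Countable ι] {γ : ι → ℂ} (hγ : Summable fun i => ‖γ i‖)
    {φ : ι → ℝ → ℂ} (hφ : ∀ i, UBfun (φ i)) {f : ℝ → ℂ} (hf : Integrable f μ) :
    HasSum (fun i => γ i * ∫ x, f x * φ i x ∂μ) (∫ x, f x * ∑' i, γ i * φ i x ∂μ) := by
  have hb : ∀ i x, ‖γ i * φ i x‖ ≤ ‖γ i‖ := fun i x => by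
    rw [norm_mul]; exact mul_le_of_le_one_right (norm_nonneg _) ((hφ i).2 x)
  have := hasSum_integral_of_dominated_convergence (μ := μ)
    (F := fun i x => γ i * (f x * φ i x)) (f := fun x => f x * ∑' i, γ i * φ i x)
    (fun i x => ‖γ i‖ * ‖f x‖)
    (fun i => ((int_mul_bc hf (hφ i).bc).const_mul _).aestronglyMeasurable)
    (fun i => Filter.Eventually.of_forall fun x => ?_)
    (Filter.Eventually.of_forall fun x => hγ.mul_right _) ?_
    (Filter.Eventually.of_forall fun x => ?_)
  · simpa only [integral_const_mul] using this
  · rw [mul_left_comm, norm_mul, mul_comm]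
    exact mul_le_mul_of_nonneg_right (hb i x) (norm_nonneg _)
  · simp only [tsum_mul_right]
    exact hf.norm.const_mul _
  · have h1 : Summable fun i => γ i * φ i x :=
      Summable.of_norm_bounded hγ fun i => hb i x
    have h2 := h1.hasSum.mul_left (f x)
    have h3 : (fun i => γ i * (f x * φ i x)) = fun i => f x * (γ i * φ i x) := by
      funext i; ring
    change HasSum (fun i => γ i * (f x * φ i x)) (f x * ∑' i, γ i * φ i x)
    rw [h3]; exact h2

lemma sform_one {n : ℕ} (u v : Fin n → ℂ) :
    sform 1 u v = ∑ q, u q * (starRingEnd ℂ) (v q) := by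
  simp [sform, Matrix.one_apply]

variable {n : ℕ}

lemma int_sform {M : ℝ → Matrix (Fin n) (Fin n) ℂ} (hM : ∀ p q, Integrable (fun x => M x p q) μ)
    {u v : ℝ → Fin n → ℂ} (hu : ∀ p, BCfun fun x => u x p) (hv : ∀ p, BCfun fun x => v x p) :
    Integrable (fun x => sform (M x) (u x) (v x)) μ := by
  unfold sform
  refine integrable_finsetSum _ fun p _ => integrable_finsetSum _ fun q _ => ?_
  have := int_mul_bc (int_mul_bc (hM p q) (hu p)) (hv q).conj
  refine this.congr (Filter.Eventually.of_forall fun x => ?_)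
  simp only; ring

lemma int_vecMul {M : ℝ → Matrix (Fin n) (Fin n) ℂ} (hM : ∀ p q, Integrable (fun x => M x p q) μ)
    {u : ℝ → Fin n → ℂ} (hu : ∀ p, BCfun fun x => u x p) (q : Fin n) :
    Integrable (fun x => Matrix.vecMul (u x) (M x) q) μ := by
  simp only [Matrix.vecMul, dotProduct]
  refine integrable_finsetSum _ fun p _ => ?_
  refine (int_mul_bc (hM p q) (hu p)).congr (Filter.Eventually.of_forall fun x => ?_)
  simp only; ring

lemma aesm_sform {M : ℝ → Matrix (Fin n) (Fin n) ℂ}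
    (hM : ∀ p q, AEStronglyMeasurable (fun x => M x p q) μ)
    {u v : ℝ → Fin n → ℂ} (hu : ∀ p, AEStronglyMeasurable (fun x => u x p) μ)
    (hv : ∀ p, AEStronglyMeasurable (fun x => v x p) μ) :
    AEStronglyMeasurable (fun x => sform (M x) (u x) (v x)) μ := by
  unfold sform
  refine Finset.aestronglyMeasurable_fun_sum _ fun p _ =>
    Finset.aestronglyMeasurable_fun_sum _ fun q _ => ?_
  exact ((hu p).mul (hM p q)).mul (Complex.continuous_conj.comp_aestronglyMeasurable (hv q))

lemma tsum_vecMul {M : ℝ → Matrix (Fin n) (Fin n) ℂ}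
    (hM : ∀ p q, Integrable (fun x => M x p q) μ)
    {a : ℤ → Fin n → ℂ} (ha : ∀ p, Summable fun j => ‖a j p‖) {φ : ℤ → ℝ → ℂ}
    (hφ : ∀ j, UBfun (φ j)) {e : ℝ → ℂ} (he : BCfun e) {cst : ℂ}
    {K : ℤ → Matrix (Fin n) (Fin n) ℂ}
    (hK : ∀ j p q, K j p q = cst * ∫ x, M x p q * e x * φ j x ∂μ)
    {A : ℝ → Fin n → ℂ} (hA : ∀ x p, A x p = ∑' j, a j p * φ j x) :
    ∑' j, Matrix.vecMul (a j) (K j) = fun q => cst * ∫ x, Matrix.vecMul (A x) (M x) q * e x ∂μ := by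
  refine HasSum.tsum_eq (Pi.hasSum.2 fun q => ?_)
  have h1 : ∀ p, HasSum (fun j => cst * (a j p * ∫ x, M x p q * e x * φ j x ∂μ))
      (cst * ∫ x, M x p q * e x * A x p ∂μ) := fun p => by
    simp only [hA]
    exact (hasSum_int (ha p) hφ (int_mul_bc (hM p q) he)).mul_left _
  have h2 := hasSum_sum (s := Finset.univ) fun p _ => h1 p
  have hbA : ∀ p, BCfun fun x => A x p := fun p => by
    simp only [hA]; exact bc_tsum (ha p) hφ
  convert h2 using 1
  · ext j
    simp only [Matrix.vecMul, dotProduct, hK]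
    exact Finset.sum_congr rfl fun p _ => by ring
  · rw [← Finset.mul_sum, ← integral_finsetSum]
    · congr 2; ext x
      simp only [Matrix.vecMul, dotProduct, Finset.sum_mul]
      exact Finset.sum_congr rfl fun p _ => by ring
    · exact fun p _ => int_mul_bc (int_mul_bc (hM p q) he) (hbA p)

lemma orth_exp (m k : ℤ) (h : m ≠ k) :
    ∫ x in Set.Ioc (-Real.pi) Real.pi, Complex.exp (-(Complex.I * (k : ℂ) * (x : ℂ))) *
      Complex.exp (Complex.I * (m : ℂ) * (x : ℂ)) = 0 := by
  rw [← intervalIntegral.integral_of_le (by linarith [Real.pi_pos])]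
  have hne : Complex.I * ((m - k : ℤ) : ℂ) ≠ 0 := by
    simp only [ne_eq, mul_eq_zero, Complex.I_ne_zero, false_or, Int.cast_eq_zero]; omega
  have : ∀ x : ℝ, Complex.exp (-(Complex.I * (k : ℂ) * (x : ℂ))) *
      Complex.exp (Complex.I * (m : ℂ) * (x : ℂ)) =
      Complex.exp (Complex.I * ((m - k : ℤ) : ℂ) * x) := fun x => by
    rw [← Complex.exp_add]; congr 1; push_cast; ring
  simp only [this]
  rw [integral_exp_mul_complex hne, div_eq_zero_iff]
  left
  rw [sub_eq_zero, Complex.exp_eq_exp_iff_exists_int]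
  exact ⟨m - k, by push_cast; ring⟩

end ana

set_option maxHeartbeats 1000000

/-- Corollary 3: filtering of the truncated functional `A_N ξ`: with
`a` supported in `Z^S ∩ {1,…,N}`, if `c` solves the normal system then the Fourier
coefficients of `h` vanish on `U`, `h` is the optimal filter, and the mean-square
error is given by formula (55). -/
theorem stmt_12
    (T s Nt : ℕ) (hT : 1 ≤ T) (hs : 1 ≤ s) (hNt : 1 ≤ Nt)
    (Mb Nb : ℕ → ℕ) (hM1 : 0 < Mb 1)
    (hMN : ∀ l, 1 ≤ l → l < s → Mb l + Nb l < Mb (l + 1))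
    (S U ZS Zneg : Set ℤ)
    (hS : S = ⋃ l ∈ Finset.Icc 1 s, Set.Icc (-((Mb l : ℤ) + (Nb l : ℤ))) (-(Mb l : ℤ)))
    (hU : U = S ∪ {j : ℤ | 0 ≤ j})
    (hZS : ZS = {j : ℤ | 1 ≤ j} \ {j : ℤ | -j ∈ S})
    (hZneg : Zneg = {j : ℤ | j < 0})
    (F G : ℝ → Matrix (Fin T) (Fin T) ℂ)
    (hFmeas : ∀ p q, Measurable fun x => F x p q)
    (hGmeas : ∀ p q, Measurable fun x => G x p q)
    (hFpsd : ∀ᵐ x : ℝ, x ∈ Set.Icc (-Real.pi) Real.pi → (F x).PosSemidef)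
    (hGpsd : ∀ᵐ x : ℝ, x ∈ Set.Icc (-Real.pi) Real.pi → (G x).PosSemidef)
    (hFint : ∀ p q, IntervalIntegrable (fun x => F x p q) volume (-Real.pi) Real.pi)
    (hGint : ∀ p q, IntervalIntegrable (fun x => G x p q) volume (-Real.pi) Real.pi)
    (hinv : ∀ᵐ x : ℝ, x ∈ Set.Icc (-Real.pi) Real.pi → IsUnit (F x + G x))
    (hmin : ∀ p q, IntervalIntegrable (fun x => (F x + G x)⁻¹ p q) volume (-Real.pi) Real.pi)
    (a : ℤ → Fin T → ℂ)
    (ha0 : ∀ j : ℤ, j ∉ ZS ∩ Set.Icc 1 (Nt : ℤ) → a j = 0)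
    (A : ℝ → Fin T → ℂ)
    (hA : ∀ x k, A x k = ∑' j : ℤ, a j k * Complex.exp (-(Complex.I * (j : ℂ) * (x : ℂ))))
    (c : ℤ → Fin T → ℂ) (hc0 : ∀ j, j ∉ U → c j = 0)
    (hcSum : Summable fun j : ℤ => ∑ k, ‖c j k‖)
    (Cf : ℝ → Fin T → ℂ)
    (hCf : ∀ x k, Cf x k = ∑' j : ℤ, c j k * Complex.exp (Complex.I * (j : ℂ) * (x : ℂ)))
    (h : ℝ → Fin T → ℂ)
    (hh : ∀ x, h x = Matrix.vecMul (A x) (F x * (F x + G x)⁻¹) -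
      Matrix.vecMul (Cf x) (F x + G x)⁻¹)
    (B R Q : ℤ → ℤ → Matrix (Fin T) (Fin T) ℂ)
    (hB : ∀ k j p q, B k j p q = (1 / (2 * (Real.pi : ℂ))) *
      ∫ x in (-Real.pi)..Real.pi,
        (F x + G x)⁻¹ p q * Complex.exp (-(Complex.I * ((k : ℂ) - (j : ℂ)) * (x : ℂ))))
    (hR : ∀ k j p q, R k j p q = (1 / (2 * (Real.pi : ℂ))) *
      ∫ x in (-Real.pi)..Real.pi,
        (F x * (F x + G x)⁻¹) p q * Complex.exp (-(Complex.I * ((k : ℂ) + (j : ℂ)) * (x : ℂ))))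
    (hQ : ∀ k j p q, Q k j p q = (1 / (2 * (Real.pi : ℂ))) *
      ∫ x in (-Real.pi)..Real.pi,
        (F x * (F x + G x)⁻¹ * G x) p q *
          Complex.exp (-(Complex.I * ((k : ℂ) - (j : ℂ)) * (x : ℂ))))
    (Δ : (ℝ → Fin T → ℂ) → ℂ)
    (hΔ : ∀ g : ℝ → Fin T → ℂ, Δ g =
      (1 / (2 * (Real.pi : ℂ))) * (∫ x in (-Real.pi)..Real.pi,
        ∑ p, ∑ q, (A x p - g x p) * F x p q * (starRingEnd ℂ) (A x q - g x q)) +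
      (1 / (2 * (Real.pi : ℂ))) * (∫ x in (-Real.pi)..Real.pi,
        ∑ p, ∑ q, g x p * G x p q * (starRingEnd ℂ) (g x q)))
    (hnormal : ∀ k ∈ U,
      (∑' j : ℤ, Matrix.vecMul (a j) (R k j)) = ∑' j : ℤ, Matrix.vecMul (c j) (B k j)) :
    (∀ k ∈ U, ∀ q, (1 / (2 * (Real.pi : ℂ))) *
        (∫ x in (-Real.pi)..Real.pi,
          h x q * Complex.exp (-(Complex.I * (k : ℂ) * (x : ℂ)))) = 0) ∧
    (∀ b : ℤ → Fin T → ℂ, (Function.support b).Finite →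
      (∀ n : ℤ, b n ≠ 0 → n ∈ Zneg \ S) →
      (Δ h).re ≤
        (Δ (fun x k => ∑' n : ℤ, b n k * Complex.exp (Complex.I * (n : ℂ) * (x : ℂ)))).re) ∧
    Δ h = (∑' k : ℤ, ∑ q,
        (∑' j : ℤ, Matrix.vecMul (a j) (R k j)) q * (starRingEnd ℂ) (c k q)) +
      ∑' jk : ℤ × ℤ, ∑ p, ∑ q,
        a jk.1 p * Q jk.1 jk.2 p q * (starRingEnd ℂ) (a jk.2 q) := by
  classical
  have hle : -Real.pi ≤ Real.pi := by linarith [Real.pi_pos]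
  have hdisj : ∀ m k : ℤ, m ∈ Zneg \ S → k ∈ U → m ≠ k := by
    rintro m k ⟨hm, hmS⟩ hk rfl
    rw [hU] at hk
    rw [hZneg] at hm
    rcases hk with hk | hk
    · exact hmS hk
    · simp only [Set.mem_ofPred_eq] at hm hk; omega
  clear hU hZS hZneg hS hMN hM1
  set μ : Measure ℝ := volume.restrict (Set.Ioc (-Real.pi) Real.pi) with hμ
  set cst : ℂ := 1 / (2 * (Real.pi : ℂ)) with hcst
  simp only [intervalIntegral.integral_of_le hle, ← hμ] at hB hR hQ hΔ ⊢
  simp only [intervalIntegrable_iff_integrableOn_Ioc_of_le hle, IntegrableOn, ← hμ]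
    at hFint hGint hmin
  have toμ : ∀ {P : ℝ → Prop}, (∀ᵐ x : ℝ, x ∈ Set.Icc (-Real.pi) Real.pi → P x) →
      ∀ᵐ x ∂μ, P x := fun hP =>
    (ae_restrict_iff' measurableSet_Ioc).2 (hP.mono fun x hx hm => hx (Set.Ioc_subset_Icc_self hm))
  have hF' := toμ hFpsd
  have hG' := toμ hGpsd
  have hV' := toμ hinv
  clear toμ hFpsd hGpsd hinv
  have hΔ' : ∀ g : ℝ → Fin T → ℂ, Δ g =
      cst * (∫ x, sform (F x) (A x - g x) (A x - g x) ∂μ) +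
      cst * (∫ x, sform (G x) (g x) (g x) ∂μ) := fun g => hΔ g
  clear hΔ
  -- exponentials
  have ubp : ∀ k : ℤ, UBfun fun x : ℝ => Complex.exp (Complex.I * (k : ℂ) * (x : ℂ)) := fun k => by
    simpa using ub_exp (k : ℝ)
  have ubm : ∀ k : ℤ, UBfun fun x : ℝ => Complex.exp (-(Complex.I * (k : ℂ) * (x : ℂ))) :=
    fun k => by simpa using ub_exp (-(k : ℝ))
  -- summability
  have sa : ∀ p, Summable fun j => ‖a j p‖ := fun p => by
    refine summable_of_ne_finset_zero (s := Finset.Icc 1 (Nt : ℤ)) fun j hj => ?_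
    rw [ha0 j (fun hh' => hj (by simpa using hh'.2))]; simp
  have sc : ∀ p, Summable fun j => ‖c j p‖ := fun p =>
    Summable.of_nonneg_of_le (fun _ => norm_nonneg _)
      (fun j => Finset.single_le_sum (f := fun k => ‖c j k‖) (fun _ _ => norm_nonneg _)
        (Finset.mem_univ p)) hcSum
  have bA : ∀ p, BCfun fun x => A x p := fun p => by
    simp only [hA]; exact bc_tsum (sa p) ubm
  have bC : ∀ p, BCfun fun x => Cf x p := fun p => by
    simp only [hCf]; exact bc_tsum (sc p) ubp
  have hconjC : ∀ x q, (starRingEnd ℂ) (Cf x q) =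
      ∑' k : ℤ, (starRingEnd ℂ) (c k q) * Complex.exp (-(Complex.I * (k : ℂ) * (x : ℂ))) := by
    intro x q
    rw [hCf, Complex.conj_tsum]
    refine tsum_congr fun k => ?_
    rw [map_mul, ← Complex.exp_conj]; simp
  have sc' : ∀ p, Summable fun j => ‖(starRingEnd ℂ) (c j p)‖ := fun p => by simpa using sc p
  -- integrability
  have iFW : ∀ p q, Integrable (fun x => (F x * (F x + G x)⁻¹) p q) μ := fun p q => by
    refine ((hFint p p).norm.add (hmin q q).norm).mono' ?_ ?_
    · simp only [Matrix.mul_apply]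
      exact Finset.aestronglyMeasurable_fun_sum _ fun k _ =>
        (hFint p k).aestronglyMeasurable.mul (hmin k q).aestronglyMeasurable
    · filter_upwards [hF', hG', hV'] with x h1 h2 h3
      exact norm_FW_le h1 h2 h3 p q
  have iFWG : ∀ p q, Integrable (fun x => (F x * (F x + G x)⁻¹ * G x) p q) μ := fun p q => by
    refine ((hFint p p).norm.add (hFint q q).norm).mono' ?_ ?_
    · simp only [Matrix.mul_apply (M := F _ * _)]
      exact Finset.aestronglyMeasurable_fun_sum _ fun k _ =>
        (iFW p k).aestronglyMeasurable.mul (hGint k q).aestronglyMeasurable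
    · filter_upwards [hF', hG', hV'] with x h1 h2 h3
      exact norm_FWG_le h1 h2 h3 p q
  have ih : ∀ q, Integrable (fun x => h x q) μ := fun q => by
    simp only [hh, Pi.sub_apply]
    exact (int_vecMul iFW bA q).sub (int_vecMul hmin bC q)
  -- the vector series
  have LR : ∀ k : ℤ, ∑' j, Matrix.vecMul (a j) (R k j) = fun q => cst *
      ∫ x, Matrix.vecMul (A x) (F x * (F x + G x)⁻¹) q *
        Complex.exp (-(Complex.I * (k : ℂ) * (x : ℂ))) ∂μ := fun k => by
    refine tsum_vecMul iFW sa ubm (ubm k).bc (fun j p q => ?_) hA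
    rw [hR]; congr 2; ext x
    rw [mul_assoc (_ : ℂ) (Complex.exp _) (Complex.exp _), ← Complex.exp_add]; congr 2; ring
  have LB : ∀ k : ℤ, ∑' j, Matrix.vecMul (c j) (B k j) = fun q => cst *
      ∫ x, Matrix.vecMul (Cf x) (F x + G x)⁻¹ q *
        Complex.exp (-(Complex.I * (k : ℂ) * (x : ℂ))) ∂μ := fun k => by
    refine tsum_vecMul hmin sc ubp (ubm k).bc (fun j p q => ?_) hCf
    rw [hB]; congr 2; ext x
    rw [mul_assoc (_ : ℂ) (Complex.exp _) (Complex.exp _), ← Complex.exp_add]; congr 2; ring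
  have part1 : ∀ k ∈ U, ∀ q, cst * (∫ x, h x q *
      Complex.exp (-(Complex.I * (k : ℂ) * (x : ℂ))) ∂μ) = 0 := by
    intro k hk q
    have := congrFun (hnormal k hk) q
    rw [LR, LB] at this
    beta_reduce at this
    simp only [hh, Pi.sub_apply, sub_mul]
    rw [integral_sub (int_mul_bc (int_vecMul iFW bA q) (ubm k).bc)
      (int_mul_bc (int_vecMul hmin bC q) (ubm k).bc), mul_sub, this, sub_self]
  have hcst0 : cst ≠ 0 := by
    simp [hcst, Real.pi_ne_zero]
  -- orthogonality to C
  have orthC : ∀ f : ℝ → ℂ, Integrable f μ → (∀ k ∈ U, ∫ x, f x *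
      Complex.exp (-(Complex.I * (k : ℂ) * (x : ℂ))) ∂μ = 0) → ∀ q,
      ∫ x, f x * (starRingEnd ℂ) (Cf x q) ∂μ = 0 := by
    intro f hf h0 q
    simp only [hconjC]
    rw [← (hasSum_int (sc' q) ubm hf).tsum_eq]
    rw [← tsum_zero (α := ℂ) (β := ℤ)]
    refine tsum_congr fun k => ?_
    by_cases hk : k ∈ U
    · rw [h0 k hk, mul_zero]
    · rw [hc0 k hk]; simp
  have hhC : ∀ q, ∫ x, h x q * (starRingEnd ℂ) (Cf x q) ∂μ = 0 := fun q =>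
    orthC _ (ih q) (fun k hk => (mul_eq_zero.1 (part1 k hk q)).resolve_left hcst0) q
  -- completing the square
  have hsq : ∀ g : ℝ → Fin T → ℂ, ∀ᵐ x ∂μ,
      sform (F x) (A x - g x) (A x - g x) + sform (G x) (g x) (g x) =
      sform (F x + G x) (g x - h x) (g x - h x) - sform 1 (Cf x) (g x - h x)
        - sform 1 (g x - h x) (Cf x)
        + (sform (F x + G x)⁻¹ (Cf x) (Cf x) + sform (F x * (F x + G x)⁻¹ * G x) (A x) (A x)) := by
    intro g
    filter_upwards [hF', hG', hV'] with x h1 h2 h3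
    exact sform_square h1 h2 h3 _ _ _ _ (hh x)
  have iWC : Integrable (fun x => sform (F x + G x)⁻¹ (Cf x) (Cf x)) μ := int_sform hmin bC bC
  have iAA : Integrable (fun x => sform (F x * (F x + G x)⁻¹ * G x) (A x) (A x)) μ :=
    int_sform iFWG bA bA
  have hsqh : ∀ᵐ x ∂μ,
      sform (F x) (A x - h x) (A x - h x) + sform (G x) (h x) (h x) =
      sform (F x + G x)⁻¹ (Cf x) (Cf x) + sform (F x * (F x + G x)⁻¹ * G x) (A x) (A x) := by
    filter_upwards [hsq h] with x hx
    rw [hx, sub_self]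
    simp [sform]
  have nn : ∀ z w : ℂ, 0 ≤ z → 0 ≤ w → ‖z‖ ≤ ‖z + w‖ := by
    intro z w hz hw
    rw [← Complex.re_eq_norm.2 hz, ← Complex.re_eq_norm.2 (add_nonneg hz hw), Complex.add_re]
    linarith [(Complex.le_def.1 hw).1, Complex.zero_re]
  have iPF : Integrable (fun x => sform (F x) (A x - h x) (A x - h x)) μ := by
    refine (iWC.add iAA).norm.mono' (aesm_sform (fun p q => (hFint p q).aestronglyMeasurable)
      (fun p => ?_) (fun p => ?_)) ?_
    · exact (bA p).1.aestronglyMeasurable.sub (ih p).aestronglyMeasurable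
    · exact (bA p).1.aestronglyMeasurable.sub (ih p).aestronglyMeasurable
    · filter_upwards [hF', hG', hsqh] with x h1 h2 h3
      simp only [Pi.add_apply]
      rw [← h3]
      exact nn _ _ (sform_nonneg h1 _) (sform_nonneg h2 _)
  have iPG : Integrable (fun x => sform (G x) (h x) (h x)) μ := by
    refine (iWC.add iAA).norm.mono' (aesm_sform (fun p q => (hGint p q).aestronglyMeasurable)
      (fun p => (ih p).aestronglyMeasurable) (fun p => (ih p).aestronglyMeasurable)) ?_
    · filter_upwards [hF', hG', hsqh] with x h1 h2 h3
      simp only [Pi.add_apply]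
      rw [← h3, add_comm]
      exact nn _ _ (sform_nonneg h2 _) (sform_nonneg h1 _)
  have hΔh : Δ h = cst * ((∫ x, sform (F x + G x)⁻¹ (Cf x) (Cf x) ∂μ) +
      ∫ x, sform (F x * (F x + G x)⁻¹ * G x) (A x) (A x) ∂μ) := by
    rw [hΔ', ← mul_add, ← integral_add iPF iPG, ← integral_add iWC iAA]
    rw [integral_congr_ae hsqh]
  refine ⟨part1, ?_, ?_⟩
  · -- optimality
    intro b hb hbS
    set g : ℝ → Fin T → ℂ := fun x k => ∑' n : ℤ, b n k *
      Complex.exp (Complex.I * (n : ℂ) * (x : ℂ)) with hg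
    have sb : ∀ p, Summable fun j => ‖b j p‖ := fun p => by
      refine summable_of_ne_finset_zero (s := hb.toFinset) fun j hj => ?_
      have : b j = 0 := by simpa using hj
      rw [this]; simp
    have bg : ∀ p, BCfun fun x => g x p := fun p => bc_tsum (sb p) ubp
    have ig : ∀ p, Integrable (fun x => g x p) μ := fun p => by
      simpa using int_mul_bc (μ := μ) (integrable_const (1 : ℂ)) (bg p)
    have hgC : ∀ q, ∫ x, g x q * (starRingEnd ℂ) (Cf x q) ∂μ = 0 := fun q => by
      refine orthC _ (ig q) (fun k hk => ?_) q
      have i1 : Integrable (fun x : ℝ => Complex.exp (-(Complex.I * (k : ℂ) * (x : ℂ)))) μ := by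
        simpa using int_mul_bc (μ := μ) (integrable_const (1 : ℂ)) (ubm k).bc
      have := (hasSum_int (sb q) ubp i1).tsum_eq
      simp only [mul_comm (g _ q)]
      rw [hg]
      simp only
      rw [← this, ← tsum_zero (α := ℂ) (β := ℤ)]
      refine tsum_congr fun m => ?_
      by_cases hm : b m = 0
      · rw [hm]; simp
      · rw [orth_exp m k (hdisj m k (hbS m hm) hk), mul_zero]
    have id : ∀ q, Integrable (fun x => (g x - h x) q * (starRingEnd ℂ) (Cf x q)) μ := fun q =>
      int_mul_bc ((ig q).sub (ih q)) (bC q).conj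
    have idC : Integrable (fun x => sform 1 (g x - h x) (Cf x)) μ := by
      simp only [sform_one]
      exact integrable_finsetSum _ fun q _ => id q
    have hdC : ∫ x, sform 1 (g x - h x) (Cf x) ∂μ = 0 := by
      simp only [sform_one]
      rw [integral_finsetSum _ fun q _ => id q]
      refine Finset.sum_eq_zero fun q _ => ?_
      simp only [Pi.sub_apply, sub_mul]
      rw [integral_sub (int_mul_bc (ig q) (bC q).conj) (int_mul_bc (ih q) (bC q).conj), hgC, hhC,
        sub_self]
    have hstar : ∀ x, sform 1 (Cf x) (g x - h x) =
        (starRingEnd ℂ) (sform 1 (g x - h x) (Cf x)) := fun x =>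
      (sform_star Matrix.isHermitian_one _ _).symm
    have iCd : Integrable (fun x => sform 1 (Cf x) (g x - h x)) μ := by
      simp only [hstar]
      exact (LinearIsometryEquiv.integrable_comp_iff Complex.conjLIE).2 idC
    have hCd : ∫ x, sform 1 (Cf x) (g x - h x) ∂μ = 0 := by
      simp only [hstar]
      rw [integral_conj, hdC, map_zero]
    have igF : Integrable (fun x => sform (F x) (A x - g x) (A x - g x)) μ :=
      int_sform hFint (fun p => (bA p).sub (bg p)) (fun p => (bA p).sub (bg p))
    have igG : Integrable (fun x => sform (G x) (g x) (g x)) μ := int_sform hGint bg bg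
    have iV : Integrable (fun x => sform (F x + G x) (g x - h x) (g x - h x)) μ := by
      refine ((((igF.add igG).add iCd).add idC).sub (iWC.add iAA)).congr ?_
      filter_upwards [hsq g] with x hx
      simp only [Pi.add_apply, Pi.sub_apply]
      rw [hx]; ring
    have e : Δ g = cst * (∫ x, sform (F x + G x) (g x - h x) (g x - h x) ∂μ) + Δ h := by
      rw [hΔ', hΔh, ← mul_add, ← integral_add igF igG, integral_congr_ae (hsq g),
        integral_add (f := fun x => sform (F x + G x) (g x - h x) (g x - h x) -
          sform 1 (Cf x) (g x - h x) - sform 1 (g x - h x) (Cf x))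
          (g := fun x => sform (F x + G x)⁻¹ (Cf x) (Cf x) +
            sform (F x * (F x + G x)⁻¹ * G x) (A x) (A x))
          ((iV.sub iCd).sub idC) (iWC.add iAA),
        integral_sub (f := fun x => sform (F x + G x) (g x - h x) (g x - h x) -
          sform 1 (Cf x) (g x - h x)) (iV.sub iCd) idC,
        integral_sub iV iCd, hdC, hCd, integral_add iWC iAA]
      ring
    have hre : 0 ≤ (∫ x, sform (F x + G x) (g x - h x) (g x - h x) ∂μ).re := by
      have := integral_re iV
      simp only [RCLike.re_eq_complex_re] at this
      rw [← this]
      refine integral_nonneg_of_ae ?_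
      filter_upwards [hF', hG'] with x h1 h2
      exact (Complex.le_def.1 (sform_nonneg (h1.add h2) _)).1
    have hcr : cst = ((1 / (2 * Real.pi) : ℝ) : ℂ) := by rw [hcst]; push_cast; rfl
    rw [e, Complex.add_re, hcr, Complex.re_ofReal_mul]
    have : 0 ≤ 1 / (2 * Real.pi) := by positivity
    nlinarith [mul_nonneg this hre]
  · -- the value of the error
    rw [hΔh, mul_add]
    congr 1
    · have i1 : ∀ q, Integrable (fun x => Matrix.vecMul (A x) (F x * (F x + G x)⁻¹) q) μ :=
        int_vecMul iFW bA
      have i2 : ∀ q, Integrable (fun x => Matrix.vecMul (Cf x) (F x + G x)⁻¹ q) μ :=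
        int_vecMul hmin bC
      have e1 : ∀ x, sform (F x + G x)⁻¹ (Cf x) (Cf x) =
          ∑ q, Matrix.vecMul (Cf x) (F x + G x)⁻¹ q * (starRingEnd ℂ) (Cf x q) := fun x => by
        rw [← sform_one, sform_vecMul_left, mul_one]
      simp only [e1]
      rw [integral_finsetSum _ fun q _ => int_mul_bc (i2 q) (bC q).conj]
      have hs1 : ∀ q, HasSum (fun k : ℤ => cst * ((starRingEnd ℂ) (c k q) *
          ∫ x, Matrix.vecMul (A x) (F x * (F x + G x)⁻¹) q *
            Complex.exp (-(Complex.I * (k : ℂ) * (x : ℂ))) ∂μ))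
          (cst * ∫ x, Matrix.vecMul (Cf x) (F x + G x)⁻¹ q * (starRingEnd ℂ) (Cf x q) ∂μ) := by
        intro q
        have h1 := (hasSum_int (sc' q) ubm (i1 q)).mul_left cst
        simp only [← hconjC] at h1
        have h2 := hhC q
        simp only [hh, Pi.sub_apply, sub_mul] at h2
        rw [integral_sub (int_mul_bc (i1 q) (bC q).conj) (int_mul_bc (i2 q) (bC q).conj),
          sub_eq_zero] at h2
        rwa [h2] at h1
      rw [Finset.mul_sum]
      refine ((hasSum_sum (s := Finset.univ) fun q _ => hs1 q).tsum_eq).symm.trans ?_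
      refine tsum_congr fun k => Finset.sum_congr rfl fun q _ => ?_
      rw [LR]; ring
    · have sa' : ∀ p, Summable fun j => ‖(starRingEnd ℂ) (a j p)‖ := fun p => by simpa using sa p
      have hconjA : ∀ x q, (starRingEnd ℂ) (A x q) =
          ∑' k : ℤ, (starRingEnd ℂ) (a k q) * Complex.exp (Complex.I * (k : ℂ) * (x : ℂ)) := by
        intro x q
        rw [hA, Complex.conj_tsum]
        refine tsum_congr fun k => ?_
        rw [map_mul, ← Complex.exp_conj]; simp
      have ubd : ∀ jk : ℤ × ℤ, UBfun fun x : ℝ =>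
          Complex.exp (-(Complex.I * ((jk.1 : ℂ) - (jk.2 : ℂ)) * (x : ℂ))) := fun jk => by
        have := ubm (jk.1 - jk.2)
        push_cast at this; exact this
      have hprod : ∀ x p q, A x p * (starRingEnd ℂ) (A x q) =
          ∑' jk : ℤ × ℤ, (a jk.1 p * (starRingEnd ℂ) (a jk.2 q)) *
            Complex.exp (-(Complex.I * ((jk.1 : ℂ) - (jk.2 : ℂ)) * (x : ℂ))) := by
        intro x p q
        rw [hconjA, hA, tsum_mul_tsum_of_summable_norm]
        · refine tsum_congr fun jk => ?_
          have : -(Complex.I * ((jk.1 : ℂ) - (jk.2 : ℂ)) * (x : ℂ)) =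
            -(Complex.I * (jk.1 : ℂ) * x) + Complex.I * (jk.2 : ℂ) * x := by ring
          rw [this, Complex.exp_add]; ring
        · refine Summable.of_nonneg_of_le (fun _ => norm_nonneg _) (fun j => ?_) (sa p)
          rw [norm_mul]; exact mul_le_of_le_one_right (norm_nonneg _) ((ubm j).2 x)
        · refine Summable.of_nonneg_of_le (fun _ => norm_nonneg _) (fun j => ?_) (sa' q)
          rw [norm_mul]; exact mul_le_of_le_one_right (norm_nonneg _) ((ubp j).2 x)
      have hs2 : ∀ p q, HasSum (fun jk : ℤ × ℤ =>
          a jk.1 p * Q jk.1 jk.2 p q * (starRingEnd ℂ) (a jk.2 q))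
          (cst * ∫ x, A x p * (F x * (F x + G x)⁻¹ * G x) p q * (starRingEnd ℂ) (A x q) ∂μ) := by
        intro p q
        have hsm : Summable fun jk : ℤ × ℤ => ‖a jk.1 p * (starRingEnd ℂ) (a jk.2 q)‖ :=
          Summable.mul_norm (f := fun j => a j p) (g := fun j => (starRingEnd ℂ) (a j q))
            (sa p) (sa' q)
        have h1 := (hasSum_int (γ := fun jk : ℤ × ℤ => a jk.1 p * (starRingEnd ℂ) (a jk.2 q))
          hsm ubd (iFWG p q)).mul_left cst
        simp only [← hprod] at h1
        have q1 : (fun jk : ℤ × ℤ => a jk.1 p * Q jk.1 jk.2 p q * (starRingEnd ℂ) (a jk.2 q)) =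
            fun jk : ℤ × ℤ => cst * (a jk.1 p * (starRingEnd ℂ) (a jk.2 q) *
              ∫ x, (F x * (F x + G x)⁻¹ * G x) p q *
                Complex.exp (-(Complex.I * ((jk.1 : ℂ) - (jk.2 : ℂ)) * (x : ℂ))) ∂μ) := by
          funext jk; rw [hQ]; ring
        have q2 : (fun x => A x p * (F x * (F x + G x)⁻¹ * G x) p q * (starRingEnd ℂ) (A x q)) =
            fun x => (F x * (F x + G x)⁻¹ * G x) p q * (A x p * (starRingEnd ℂ) (A x q)) := by
          funext x; ring
        rw [q1, q2]
        exact h1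
      have i3 : ∀ p q, Integrable (fun x => A x p * (F x * (F x + G x)⁻¹ * G x) p q *
          (starRingEnd ℂ) (A x q)) μ := fun p q => by
        refine (int_mul_bc (int_mul_bc (iFWG p q) (bA p)) (bA q).conj).congr
          (Filter.Eventually.of_forall fun x => ?_)
        simp only; ring
      have hs3 : HasSum (fun jk : ℤ × ℤ => ∑ p, ∑ q,
          a jk.1 p * Q jk.1 jk.2 p q * (starRingEnd ℂ) (a jk.2 q)) (∑ p, ∑ q,
          (cst * ∫ x, A x p * (F x * (F x + G x)⁻¹ * G x) p q * (starRingEnd ℂ) (A x q) ∂μ)) :=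
        hasSum_sum fun p _ => hasSum_sum fun q _ => hs2 p q
      rw [hs3.tsum_eq]
      unfold sform
      rw [integral_finsetSum _ fun p _ => integrable_finsetSum _ fun q _ => i3 p q, Finset.mul_sum]
      refine Finset.sum_congr rfl fun p _ => ?_
      rw [integral_finsetSum _ fun q _ => i3 p q, Finset.mul_sum]
end
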